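/- arXiv:2408.09561 — 12 statements merged into one kernel-verified Lean document; each statement's English description precedes it below -/
import Mathlib

section
/- Suppose the characteristic polynomial p(x) = x² − a·x − b of Q has two distinct roots γ₁, γ₂ in 𝔽_q. Then the orbit length of every nonzero vector v ∈ 𝔽_q² equals ord(γ₁), or ord(γ₂), or lcm(ord(γ₁), ord(γ₂)). -/
open Matrix

theorem Matrix.dotProduct_pow_mulVec_of_vecMul_eq_smul {R n : Type*} [CommRing R] [Fintype n]
    [DecidableEq n] {A : Matrix n n R} {w : n → R} {c : R} (h : w ᵥ* A = c • w) (k : ℕ)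
    (v : n → R) : w ⬝ᵥ (A ^ k *ᵥ v) = c ^ k * (w ⬝ᵥ v) := by
  induction k with
  | zero => simp
  | succ k ih =>
    rw [pow_succ', ← Matrix.mulVec_mulVec, Matrix.dotProduct_mulVec, h, smul_dotProduct, ih,
      smul_eq_mul, pow_succ', mul_assoc]

theorem eq_of_isLeast_pos_of_forall_iff_dvd {P : ℕ → Prop} {d l : ℕ} (hd : 0 < d)
    (hP : ∀ n, P n ↔ d ∣ n) (hl : IsLeast {n : ℕ | 0 < n ∧ P n} l) : l = d :=
  le_antisymm (hl.2 ⟨hd, (hP d).2 dvd_rfl⟩) (Nat.le_of_dvd hl.1.1 ((hP l).1 hl.1.2))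

/-- If `γ` and `δ` are the roots of `x² - a·x - b`, then `![1, -δ]` is a left eigenvector of
`!![a, b; 1, 0]` with eigenvalue `γ`. -/
theorem vecMul_companion_eq_smul {R : Type*} [CommRing R] {a b γ δ : R} (hsum : γ + δ = a)
    (hprod : γ * δ = -b) : ![1, -δ] ᵥ* !![a, b; 1, 0] = γ • ![1, -δ] := by
  ext i
  fin_cases i
  · simp [Matrix.vecMul, dotProduct, Fin.sum_univ_two]
    linear_combination -hsum
  · simp [Matrix.vecMul, dotProduct, Fin.sum_univ_two]
    linear_combination hprod

theorem eq_iff_dotProduct_one_neg_eq {F : Type*} [Field F] {γ δ : F} (hne : γ ≠ δ)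
    (u v : Fin 2 → F) :
    u = v ↔ ![1, -δ] ⬝ᵥ u = ![1, -δ] ⬝ᵥ v ∧ ![1, -γ] ⬝ᵥ u = ![1, -γ] ⬝ᵥ v := by
  refine ⟨fun h => by simp [h], fun ⟨h₁, h₂⟩ => ?_⟩
  simp only [dotProduct, Fin.sum_univ_two, Matrix.cons_val_zero, Matrix.cons_val_one,
    one_mul] at h₁ h₂
  have h : u 1 = v 1 := mul_left_cancel₀ (sub_ne_zero.2 hne) (by linear_combination h₁ - h₂)
  ext i
  fin_cases i
  · exact show u 0 = v 0 by linear_combination h₁ + δ * h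
  · exact h

theorem orderOf_pos_of_ne_zero {F : Type*} [Field F] [Fintype F] {x : F} (hx : x ≠ 0) :
    0 < orderOf x :=
  (isOfFinOrder_iff_pow_eq_one.2 ⟨_, Nat.sub_pos_of_lt Fintype.one_lt_card,
    FiniteField.pow_card_sub_one_eq_one x hx⟩).orderOf_pos

/-- If the characteristic polynomial `x² - a·x - b` of
`Q = !![a, b; 1, 0]` has two distinct roots `γ₁, γ₂` in `𝔽_q`, then the orbit
length of every nonzero vector `v` equals `orderOf γ₁`, `orderOf γ₂`, or
`lcm (orderOf γ₁) (orderOf γ₂)`. -/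
theorem orbit_length_distinct_roots {F : Type*} [Field F] [Fintype F]
    (a b : F) (hb : b ≠ 0)
    (Q : Matrix (Fin 2) (Fin 2) F) (hQ : Q = !![a, b; 1, 0])
    (γ₁ γ₂ : F) (hne : γ₁ ≠ γ₂) (hsum : γ₁ + γ₂ = a) (hprod : γ₁ * γ₂ = -b)
    (v : Fin 2 → F) (hv : v ≠ 0) (l : ℕ)
    (hl : IsLeast {n : ℕ | 0 < n ∧ Q ^ n *ᵥ v = v} l) :
    l = orderOf γ₁ ∨ l = orderOf γ₂ ∨ l = Nat.lcm (orderOf γ₁) (orderOf γ₂) := by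
  subst hQ
  have hpos₁ : 0 < orderOf γ₁ := orderOf_pos_of_ne_zero (by rintro rfl; simp_all)
  have hpos₂ : 0 < orderOf γ₂ := orderOf_pos_of_ne_zero (by rintro rfl; simp_all)
  have key (n : ℕ) : !![a, b; 1, 0] ^ n *ᵥ v = v ↔
      (orderOf γ₁ ∣ n ∨ ![1, -γ₂] ⬝ᵥ v = 0) ∧ (orderOf γ₂ ∣ n ∨ ![1, -γ₁] ⬝ᵥ v = 0) := by
    rw [eq_iff_dotProduct_one_neg_eq hne,
      dotProduct_pow_mulVec_of_vecMul_eq_smul (vecMul_companion_eq_smul hsum hprod),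
      dotProduct_pow_mulVec_of_vecMul_eq_smul
        (vecMul_companion_eq_smul (add_comm γ₁ γ₂ ▸ hsum) (mul_comm γ₁ γ₂ ▸ hprod)),
      mul_left_eq_self₀, mul_left_eq_self₀, orderOf_dvd_iff_pow_eq_one, orderOf_dvd_iff_pow_eq_one]
  by_cases h₁ : ![1, -γ₂] ⬝ᵥ v = 0 <;> by_cases h₂ : ![1, -γ₁] ⬝ᵥ v = 0
  · exact absurd ((eq_iff_dotProduct_one_neg_eq hne v 0).2
      (by simp only [h₁, h₂, dotProduct_zero, and_self])) hv
  · exact .inr (.inl (eq_of_isLeast_pos_of_forall_iff_dvd hpos₂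
      (fun n => by simp only [key, h₁, h₂, or_true, or_false, true_and]) hl))
  · exact .inl (eq_of_isLeast_pos_of_forall_iff_dvd hpos₁
      (fun n => by simp only [key, h₁, h₂, or_true, or_false, and_true]) hl)
  · exact .inr (.inr (eq_of_isLeast_pos_of_forall_iff_dvd (Nat.lcm_pos hpos₁ hpos₂)
      (fun n => by simp only [key, h₁, h₂, or_false, Nat.lcm_dvd_iff]) hl))
end

section
/- Suppose the characteristic polynomial p(x) = x² − a·x − b of Q has two distinct roots in 𝔽_q and that r = ord(−b) is a prime number. Then exactly one of the following holds: (a) there is a positive integer m with r dividing m such that every nonzero vector in 𝔽_q² has orbit length m; or (b) there is a positive integer m with r not dividing m such that every nonzero vector in 𝔽_q² has orbit length m or r·m, and both lengths occur. -/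
open Matrix

/-- In the coordinates dual to the eigenvectors, the companion matrix acts diagonally. -/
theorem companion_pow_mulVec_sub {F : Type*} [Field F] (γ δ : F) (v : Fin 2 → F) (l : ℕ) :
    (!![γ + δ, -(γ * δ); 1, 0] ^ l *ᵥ v) 0 - δ * (!![γ + δ, -(γ * δ); 1, 0] ^ l *ᵥ v) 1 =
      γ ^ l * (v 0 - δ * v 1) := by
  induction l with
  | zero => simp
  | succ l ih =>
    rw [pow_succ', ← mulVec_mulVec, pow_succ', mul_assoc, ← ih]
    generalize !![γ + δ, -(γ * δ); 1, 0] ^ l *ᵥ v = w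
    simp [mulVec, dotProduct, Fin.sum_univ_two]
    ring

theorem eq_of_sub_mul_eq {F : Type*} [Field F] {γ δ : F} (hne : γ ≠ δ) {v w : Fin 2 → F}
    (h₁ : v 0 - δ * v 1 = w 0 - δ * w 1) (h₂ : v 0 - γ * v 1 = w 0 - γ * w 1) : v = w := by
  have hv : v 1 = w 1 := mul_left_cancel₀ (sub_ne_zero.mpr hne) (by linear_combination h₁ - h₂)
  ext i
  fin_cases i
  · show v 0 = w 0
    linear_combination h₁ + δ * hv
  · exact hv

theorem companion_pow_mulVec_eq_self_iff {F : Type*} [Field F] {γ δ : F} (hne : γ ≠ δ)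
    (v : Fin 2 → F) (l : ℕ) :
    !![γ + δ, -(γ * δ); 1, 0] ^ l *ᵥ v = v ↔
      (orderOf γ ∣ l ∨ v 0 - δ * v 1 = 0) ∧ (orderOf δ ∣ l ∨ v 0 - γ * v 1 = 0) := by
  have h₁ := companion_pow_mulVec_sub γ δ v l
  have h₂ := companion_pow_mulVec_sub δ γ v l
  rw [add_comm δ γ, mul_comm δ γ] at h₂
  rw [orderOf_dvd_iff_pow_eq_one, orderOf_dvd_iff_pow_eq_one, ← mul_left_eq_self₀, ← mul_left_eq_self₀,
    ← h₁, ← h₂]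
  exact ⟨fun h => by rw [h]; exact ⟨rfl, rfl⟩, fun h => eq_of_sub_mul_eq hne h.1 h.2⟩

theorem isLeast_pos_of_iff_dvd {p : ℕ → Prop} {n : ℕ} (hn : 0 < n) (h : ∀ l, p l ↔ n ∣ l) :
    IsLeast {l : ℕ | 0 < l ∧ p l} n :=
  ⟨⟨hn, (h n).mpr dvd_rfl⟩, fun l hl => Nat.le_of_dvd hl.1 ((h l).mp hl.2)⟩

theorem orderOf_eq_mul_of_mul {F : Type*} [Field F] {γ δ : F} (hγ : γ ≠ 0)
    (h : (orderOf (γ * δ)).Coprime (orderOf γ)) :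
    orderOf δ = orderOf (γ * δ) * orderOf γ := by
  have hinv : orderOf γ⁻¹ = orderOf γ :=
    orderOf_eq_orderOf_iff.mpr fun n => by rw [inv_pow, inv_eq_one]
  have hδ : δ = γ * δ * γ⁻¹ := by field_simp
  rw [← hinv] at h ⊢
  conv_lhs => rw [hδ]
  exact (Commute.all _ _).orderOf_mul_eq_mul_orderOf_of_coprime h

theorem orderOf_dvd_of_orderOf_mul_dvd {M : Type*} [CommMonoid M] {γ δ : M}
    (h : orderOf (γ * δ) ∣ orderOf γ) : orderOf δ ∣ orderOf γ := by
  have := orderOf_dvd_iff_pow_eq_one.mp h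
  rw [mul_pow, pow_orderOf_eq_one, one_mul] at this
  exact orderOf_dvd_of_pow_eq_one this

theorem orderOf_pos_of_ne_zero_s6 {F : Type*} [Field F] [Finite F] {γ : F} (hγ : γ ≠ 0) :
    0 < orderOf γ := by
  simpa only [← orderOf_units, Units.val_mk0] using orderOf_pos (Units.mk0 γ hγ)

theorem companion_orbit_lengths_of_not_dvd {F : Type*} [Field F] [Finite F] {γ δ : F}
    (hne : γ ≠ δ) (hγ : γ ≠ 0) (hδ : δ ≠ 0) (hp : (orderOf (γ * δ)).Prime)
    (h : ¬ orderOf (γ * δ) ∣ orderOf γ) :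
    (∀ v : Fin 2 → F, v ≠ 0 →
      IsLeast {l : ℕ | 0 < l ∧ !![γ + δ, -(γ * δ); 1, 0] ^ l *ᵥ v = v} (orderOf γ) ∨
      IsLeast {l : ℕ | 0 < l ∧ !![γ + δ, -(γ * δ); 1, 0] ^ l *ᵥ v = v}
        (orderOf (γ * δ) * orderOf γ)) ∧
    (∃ v : Fin 2 → F, v ≠ 0 ∧
      IsLeast {l : ℕ | 0 < l ∧ !![γ + δ, -(γ * δ); 1, 0] ^ l *ᵥ v = v} (orderOf γ)) ∧
    (∃ v : Fin 2 → F, v ≠ 0 ∧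
      IsLeast {l : ℕ | 0 < l ∧ !![γ + δ, -(γ * δ); 1, 0] ^ l *ᵥ v = v}
        (orderOf (γ * δ) * orderOf γ)) := by
  have hord := orderOf_eq_mul_of_mul hγ ((hp.coprime_iff_not_dvd).mpr h)
  have hdvd : orderOf γ ∣ orderOf δ := hord ▸ dvd_mul_left _ _
  rw [← hord]
  have short (v : Fin 2 → F) (hv : v ≠ 0) (hc : v 0 - γ * v 1 = 0) :
      IsLeast {l : ℕ | 0 < l ∧ !![γ + δ, -(γ * δ); 1, 0] ^ l *ᵥ v = v} (orderOf γ) := by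
    refine isLeast_pos_of_iff_dvd (orderOf_pos_of_ne_zero_s6 hγ) fun l => ?_
    have hc' : v 0 - δ * v 1 ≠ 0 := fun h' =>
      hv (eq_of_sub_mul_eq hne (by simpa using h') (by simpa using hc))
    rw [companion_pow_mulVec_eq_self_iff hne, or_iff_left hc', and_iff_left (Or.inr hc)]
  have long (v : Fin 2 → F) (hc : v 0 - γ * v 1 ≠ 0) :
      IsLeast {l : ℕ | 0 < l ∧ !![γ + δ, -(γ * δ); 1, 0] ^ l *ᵥ v = v} (orderOf δ) := by
    refine isLeast_pos_of_iff_dvd (orderOf_pos_of_ne_zero_s6 hδ) fun l => ?_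
    rw [companion_pow_mulVec_eq_self_iff hne, or_iff_left hc]
    exact ⟨And.right, fun hl => ⟨Or.inl (hdvd.trans hl), hl⟩⟩
  have ne_zero (x : F) : ![x, 1] ≠ 0 := fun h' => by simpa using congrFun h' 1
  refine ⟨fun v hv => ?_, ⟨![γ, 1], ne_zero γ, short _ (ne_zero γ) (by simp)⟩,
    ⟨![δ, 1], ne_zero δ, long _ (by simpa [sub_eq_zero] using hne.symm)⟩⟩
  by_cases hc : v 0 - γ * v 1 = 0
  · exact Or.inl (short v hv hc)
  · exact Or.inr (long v hc)

theorem companion_orbit_length_of_orderOf_eq {F : Type*} [Field F] [Finite F] {γ δ : F}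
    (hne : γ ≠ δ) (hγ : γ ≠ 0) (h : orderOf γ = orderOf δ) (v : Fin 2 → F) (hv : v ≠ 0) :
    IsLeast {l : ℕ | 0 < l ∧ !![γ + δ, -(γ * δ); 1, 0] ^ l *ᵥ v = v} (orderOf γ) := by
  refine isLeast_pos_of_iff_dvd (orderOf_pos_of_ne_zero_s6 hγ) fun l => ?_
  rw [companion_pow_mulVec_eq_self_iff hne, ← h, ← or_and_left]
  exact or_iff_left fun h' => hv (eq_of_sub_mul_eq hne (by simpa using h'.1) (by simpa using h'.2))

/-- if `Q = !![a, b; 1, 0]` has distinct roots over `𝔽_q` and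
`r = ord(-b)` is prime, then exactly one of the following holds:
(a) there is `m > 0` with `r ∣ m` such that every nonzero vector has orbit length `m`;
(b) there is `m > 0` with `r ∤ m` such that every nonzero vector has orbit length `m`
or `r·m`, and both lengths occur. -/
theorem orbit_lengths_prime_order {F : Type*} [Field F] [Fintype F]
    (a b : F) (hb : b ≠ 0)
    (Q : Matrix (Fin 2) (Fin 2) F) (hQ : Q = !![a, b; 1, 0])
    (γ₁ γ₂ : F) (hne : γ₁ ≠ γ₂) (hsum : γ₁ + γ₂ = a) (hprod : γ₁ * γ₂ = -b)
    (r : ℕ) (hr : orderOf (-b) = r) (hrp : r.Prime) :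
    Xor'
      (∃ m : ℕ, 0 < m ∧ r ∣ m ∧ ∀ v : Fin 2 → F, v ≠ 0 →
        IsLeast {l : ℕ | 0 < l ∧ Q ^ l *ᵥ v = v} m)
      (∃ m : ℕ, 0 < m ∧ ¬ r ∣ m ∧
        (∀ v : Fin 2 → F, v ≠ 0 →
          IsLeast {l : ℕ | 0 < l ∧ Q ^ l *ᵥ v = v} m ∨
          IsLeast {l : ℕ | 0 < l ∧ Q ^ l *ᵥ v = v} (r * m)) ∧
        (∃ v : Fin 2 → F, v ≠ 0 ∧ IsLeast {l : ℕ | 0 < l ∧ Q ^ l *ᵥ v = v} m) ∧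
        (∃ v : Fin 2 → F, v ≠ 0 ∧ IsLeast {l : ℕ | 0 < l ∧ Q ^ l *ᵥ v = v} (r * m))) := by
  obtain rfl : b = -(γ₁ * γ₂) := by rw [hprod, neg_neg]
  subst hQ hsum hr
  rw [neg_neg] at hrp ⊢
  have h₁ : γ₁ ≠ 0 := by rintro rfl; simp at hb
  have h₂ : γ₂ ≠ 0 := by rintro rfl; simp at hb
  refine (xor_iff_or_and_not_and _ _).mpr ⟨?_, ?_⟩
  · by_cases hd₁ : orderOf (γ₁ * γ₂) ∣ orderOf γ₁
    · by_cases hd₂ : orderOf (γ₁ * γ₂) ∣ orderOf γ₂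
      · have heq : orderOf γ₁ = orderOf γ₂ := Nat.dvd_antisymm
          (orderOf_dvd_of_orderOf_mul_dvd (by rwa [mul_comm])) (orderOf_dvd_of_orderOf_mul_dvd hd₁)
        exact Or.inl ⟨orderOf γ₁, orderOf_pos_of_ne_zero_s6 h₁, hd₁,
          companion_orbit_length_of_orderOf_eq hne h₁ heq⟩
      · rw [mul_comm γ₁, add_comm γ₁] at *
        exact Or.inr ⟨orderOf γ₂, orderOf_pos_of_ne_zero_s6 h₂, hd₂,
          companion_orbit_lengths_of_not_dvd hne.symm h₂ h₁ hrp hd₂⟩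
    · exact Or.inr ⟨orderOf γ₁, orderOf_pos_of_ne_zero_s6 h₁, hd₁,
        companion_orbit_lengths_of_not_dvd hne h₁ h₂ hrp hd₁⟩
  · rintro ⟨⟨m, -, hm, hall⟩, n, -, hn, -, ⟨v, hv, hvn⟩, -⟩
    exact hn ((hall v hv).unique hvn ▸ hm)
end

section
/- Let F be an abelian group and let γ₁, γ₂, γ₃ ∈ F satisfy γ₁·γ₂ = γ₃, with finite orders m = |γ₁|, n = |γ₂|, and r = |γ₃| = p·s where p is a prime and s is a positive integer. Assume v_p(m) ≤ v_p(n). Then n = (gcd(n, s)/gcd(m, s))·m if v_p(m) > v_p(s), and n = p·(gcd(n, s)/gcd(m, s))·m if v_p(m) ≤ v_p(s). -/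
/-- The `q`-adic valuation of a divisor of `lcm b c` is at most that of `b` or of `c`. -/
theorem Nat.factorization_le_max_of_dvd_lcm {a b c : ℕ} (hb : b ≠ 0) (hc : c ≠ 0)
    (h : a ∣ Nat.lcm b c) (q : ℕ) :
    a.factorization q ≤ max (b.factorization q) (c.factorization q) := by
  have h1 := (Nat.factorization_le_iff_dvd (ne_zero_of_dvd_ne_zero (Nat.lcm_ne_zero hb hc) h)
    (Nat.lcm_ne_zero hb hc)).2 h q
  simpa [Nat.factorization_lcm hb hc] using h1

/-- in an abelian group, suppose `γ₁·γ₂ = γ₃` with finite orders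
`m = |γ₁|`, `n = |γ₂|`, `r = |γ₃| = p·s` (`p` prime, `s ≥ 1`), and `v_p(m) ≤ v_p(n)`.
Then `n = (gcd(n,s)/gcd(m,s))·m` if `v_p(m) > v_p(s)`, and
`n = p·(gcd(n,s)/gcd(m,s))·m` if `v_p(m) ≤ v_p(s)`
(stated in cross-multiplied form to avoid natural-number division). -/
theorem order_rel_of_order_eq_prime_mul {F : Type*} [CommGroup F] (γ₁ γ₂ γ₃ : F)
    (h : γ₁ * γ₂ = γ₃) (m n r : ℕ)
    (hm : orderOf γ₁ = m) (hn : orderOf γ₂ = n) (hr : orderOf γ₃ = r)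
    (hm0 : 0 < m) (hn0 : 0 < n)
    (p s : ℕ) (hp : p.Prime) (hs : 0 < s) (hrps : r = p * s)
    (hv : padicValNat p m ≤ padicValNat p n) :
    (padicValNat p s < padicValNat p m → Nat.gcd m s * n = Nat.gcd n s * m) ∧
    (padicValNat p m ≤ padicValNat p s → Nat.gcd m s * n = p * (Nat.gcd n s * m)) := by
  have hm' := hm0.ne'
  have hn' := hn0.ne'
  have hs' := hs.ne'
  have hr' : r ≠ 0 := hrps ▸ mul_ne_zero hp.ne_zero hs'
  have h1 : r ∣ Nat.lcm m n := by
    rw [← hr, ← hm, ← hn, ← h]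
    exact (Commute.all γ₁ γ₂).orderOf_mul_dvd_lcm
  have h2 : m ∣ Nat.lcm r n := by
    have := (Commute.all γ₃ γ₂⁻¹).orderOf_mul_dvd_lcm
    rwa [orderOf_inv, ← h, mul_inv_cancel_right, h, hm, hn, hr] at this
  have h3 : n ∣ Nat.lcm m r := by
    have := (Commute.all γ₁⁻¹ γ₃).orderOf_mul_dvd_lcm
    rwa [orderOf_inv, ← h, inv_mul_cancel_left, h, hm, hn, hr] at this
  have v1 := Nat.factorization_le_max_of_dvd_lcm hm' hn' h1
  have v2 := Nat.factorization_le_max_of_dvd_lcm hr' hn' h2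
  have v3 := Nat.factorization_le_max_of_dvd_lcm hm' hr' h3
  have vr (q : ℕ) : r.factorization q = (if p = q then 1 else 0) + s.factorization q := by
    rw [hrps, Nat.factorization_mul hp.ne_zero hs', hp.factorization, Finsupp.add_apply,
      Finsupp.single_apply]
  have hgm : Nat.gcd m s ≠ 0 := Nat.gcd_ne_zero_left hm'
  have hgn : Nat.gcd n s ≠ 0 := Nat.gcd_ne_zero_left hn'
  simp only [← Nat.factorization_def _ hp] at hv ⊢
  refine ⟨fun hlt => ?_, fun hle => ?_⟩
  · refine Nat.eq_of_factorization_eq (mul_ne_zero hgm hn') (mul_ne_zero hgn hm') fun q => ?_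
    rw [Nat.factorization_mul hgm hn', Nat.factorization_mul hgn hm',
      Nat.factorization_gcd hm' hs', Nat.factorization_gcd hn' hs']
    simp only [Finsupp.add_apply, Finsupp.inf_apply]
    specialize v1 q; specialize v2 q; specialize v3 q; specialize vr q
    split_ifs at vr with hq
    · subst hq; omega
    · omega
  · refine Nat.eq_of_factorization_eq (mul_ne_zero hgm hn')
      (mul_ne_zero hp.ne_zero (mul_ne_zero hgn hm')) fun q => ?_
    rw [Nat.factorization_mul hgm hn', Nat.factorization_mul hp.ne_zero (mul_ne_zero hgn hm'),
      Nat.factorization_mul hgn hm', Nat.factorization_gcd hm' hs',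
      Nat.factorization_gcd hn' hs', hp.factorization]
    simp only [Finsupp.add_apply, Finsupp.inf_apply, Finsupp.single_apply]
    specialize v1 q; specialize v2 q; specialize v3 q; specialize vr q
    split_ifs at vr ⊢ with hq
    · subst hq; omega
    · omega
end

section
/- Let F be an abelian group and let γ₁, γ₂, γ₃ ∈ F satisfy γ₁·γ₂ = γ₃, with finite orders m = |γ₁|, n = |γ₂|, and r = |γ₃| = p^α where p is a prime and α is a positive integer. Let k = v_p(m) and assume v_p(m) ≤ v_p(n). Then n = m if v_p(m) ≥ α, and n = p^(α−k)·m if v_p(m) < α. -/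
/-- A prime power dividing `lcm m n` divides `m` or `n`. -/
theorem Nat.Prime.pow_dvd_or_pow_dvd_of_dvd_lcm {p a m n : ℕ} (hp : p.Prime) (hm : m ≠ 0)
    (hn : n ≠ 0) (h : p ^ a ∣ Nat.lcm m n) : p ^ a ∣ m ∨ p ^ a ∣ n := by
  rw [hp.pow_dvd_iff_le_factorization (Nat.lcm_ne_zero hm hn), Nat.factorization_lcm hm hn,
    Finsupp.sup_apply, le_sup_iff] at h
  rwa [hp.pow_dvd_iff_le_factorization hm, hp.pow_dvd_iff_le_factorization hn]

/-- The least common multiple of `m` and a power `p ^ a` with `padicValNat p m ≤ a`. -/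
theorem Nat.Prime.lcm_pow_eq {p a m : ℕ} (hp : p.Prime) (hm : m ≠ 0)
    (h : padicValNat p m ≤ a) : Nat.lcm m (p ^ a) = p ^ (a - padicValNat p m) * m := by
  have := Fact.mk hp
  obtain ⟨b, hb⟩ := pow_padicValNat_dvd (p := p) (n := m)
  set k := padicValNat p m with hk
  have hpb : ¬ p ∣ b := by
    rintro ⟨c, rfl⟩
    exact pow_succ_padicValNat_not_dvd (p := p) hm ⟨c, by rw [← hk, hb]; ring⟩
  have ha : p ^ a = p ^ k * p ^ (a - k) := by rw [← pow_add, Nat.add_sub_cancel' h]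
  have hcop : Nat.Coprime b (p ^ (a - k)) :=
    (((Nat.Prime.coprime_iff_not_dvd hp).2 hpb).symm).pow_right _
  calc Nat.lcm m (p ^ a) = Nat.lcm (p ^ k * b) (p ^ k * p ^ (a - k)) := by rw [← hb, ← ha]
    _ = p ^ k * (b * p ^ (a - k)) := by rw [Nat.lcm_mul_left, hcop.lcm_eq_mul]
    _ = p ^ (a - k) * (p ^ k * b) := by ring
    _ = p ^ (a - k) * m := by rw [← hb]

/-- in an abelian group, suppose `γ₁·γ₂ = γ₃` with finite orders
`m = |γ₁|`, `n = |γ₂|`, `r = |γ₃| = p^α` (`p` prime, `α ≥ 1`), `k = v_p(m)` and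
`v_p(m) ≤ v_p(n)`. Then `n = m` if `v_p(m) ≥ α`, and `n = p^(α-k)·m` if `v_p(m) < α`. -/
theorem order_rel_of_order_eq_prime_pow {F : Type*} [CommGroup F] (γ₁ γ₂ γ₃ : F)
    (h : γ₁ * γ₂ = γ₃) (m n r : ℕ)
    (hm : orderOf γ₁ = m) (hn : orderOf γ₂ = n) (hr : orderOf γ₃ = r)
    (hm0 : 0 < m) (hn0 : 0 < n)
    (p α : ℕ) (hp : p.Prime) (hα : 0 < α) (hrpα : r = p ^ α)
    (k : ℕ) (hk : padicValNat p m = k)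
    (hv : padicValNat p m ≤ padicValNat p n) :
    (α ≤ padicValNat p m → n = m) ∧
    (padicValNat p m < α → n = p ^ (α - k) * m) := by
  have := Fact.mk hp
  subst hk
  have hr' : orderOf γ₃ = p ^ α := hr.trans hrpα
  have h₁ : m ∣ Nat.lcm n (p ^ α) := by
    have := (Commute.all γ₂⁻¹ γ₃).orderOf_mul_dvd_lcm
    rwa [← h, mul_comm γ₁, inv_mul_cancel_left, mul_comm γ₂, h, orderOf_inv, hm, hn, hr'] at this
  have h₂ : n ∣ Nat.lcm m (p ^ α) := by
    have := (Commute.all γ₁⁻¹ γ₃).orderOf_mul_dvd_lcm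
    rwa [← h, inv_mul_cancel_left, h, orderOf_inv, hm, hn, hr'] at this
  have h₃ : p ^ α ∣ Nat.lcm m n := by
    have := (Commute.all γ₁ γ₂).orderOf_mul_dvd_lcm
    rwa [h, hm, hn, hr'] at this
  constructor
  · intro hle
    have hpm : p ^ α ∣ m := (padicValNat_dvd_iff_le hm0.ne').2 hle
    have hpn : p ^ α ∣ n := (padicValNat_dvd_iff_le hn0.ne').2 (hle.trans hv)
    exact Nat.dvd_antisymm (h₂.trans (Nat.lcm_dvd dvd_rfl hpm))
      (h₁.trans (Nat.lcm_dvd dvd_rfl hpn))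
  · intro hlt
    have hpn : p ^ α ∣ n :=
      (hp.pow_dvd_or_pow_dvd_of_dvd_lcm hm0.ne' hn0.ne' h₃).resolve_left fun hpm =>
        hlt.not_ge ((padicValNat_dvd_iff_le hm0.ne').1 hpm)
    rw [← hp.lcm_pow_eq hm0.ne' hlt.le]
    exact Nat.dvd_antisymm h₂ (Nat.lcm_dvd (h₁.trans (Nat.lcm_dvd dvd_rfl hpn)) hpn)
end

section
/- Suppose the characteristic polynomial p(x) = x² − a·x − b of Q has two distinct roots in 𝔽_q and that ord(−b) = p^α for a prime p and positive integer α. Then exactly one of the following holds: (a) there is a positive integer l with v_p(l) ≥ α such that every nonzero vector in 𝔽_q² has orbit length l; or (b) there is a positive integer l with k = v_p(l) < α such that every nonzero vector in 𝔽_q² has orbit length l or p^(α−k)·l, and both lengths occur. -/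
open Matrix

theorem Nat.eq_pow_mul_of_dvd_lcm_prime_pow {p α m n : ℕ} (hp : p.Prime) (hm : m ≠ 0) (hn : n ≠ 0)
    (hnm : n ∣ m.lcm (p ^ α)) (hmn : m ∣ n.lcm (p ^ α)) (hα : p ^ α ∣ m.lcm n)
    (hlt : padicValNat p m ≤ padicValNat p n) :
    (m = n ∧ α ≤ padicValNat p m) ∨
      (padicValNat p m < α ∧ n = p ^ (α - padicValNat p m) * m) := by
  have : Fact p.Prime := ⟨hp⟩
  obtain ⟨i, u, hu, rfl⟩ := Nat.exists_eq_pow_mul_and_not_dvd hm p hp.ne_one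
  obtain ⟨j, w, hw, rfl⟩ := Nat.exists_eq_pow_mul_and_not_dvd hn p hp.ne_one
  have hval : ∀ k x, ¬ p ∣ x → padicValNat p (p ^ k * x) = k := by
    intro k x hx
    have hx0 : x ≠ 0 := by rintro rfl; exact hx (dvd_zero p)
    rw [padicValNat.mul (pow_ne_zero _ hp.ne_zero) hx0, padicValNat.prime_pow,
      padicValNat.eq_zero_of_not_dvd hx, add_zero]
  have hdvd : ∀ k l x y, ¬ p ∣ x → p ^ k * x ∣ (p ^ l * y).lcm (p ^ α) → x ∣ y := by
    intro k l x y hx h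
    have hc : x.Coprime p := ((Nat.Prime.coprime_iff_not_dvd hp).2 hx).symm
    have h' : x ∣ p ^ l * y * p ^ α :=
      (Dvd.intro_left _ rfl).trans (h.trans (Nat.lcm_dvd_mul _ _))
    exact (hc.pow_right l).dvd_of_dvd_mul_left ((hc.pow_right α).dvd_of_dvd_mul_right h')
  obtain rfl : u = w := Nat.dvd_antisymm (hdvd _ _ _ _ hu hmn) (hdvd _ _ _ _ hw hnm)
  rw [hval _ _ hu, hval _ _ hu] at hlt
  rw [hval _ _ hu]
  have hpow : ∀ k l, p ^ k ∣ p ^ l * u → k ≤ l := fun k l h =>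
    (Nat.pow_dvd_pow_iff_le_right hp.one_lt).1 ((Nat.Coprime.pow_left k
      ((Nat.Prime.coprime_iff_not_dvd hp).2 hu)).dvd_of_dvd_mul_right h)
  have hαj : α ≤ j := hpow _ _ (hα.trans (Nat.lcm_dvd
    (Nat.mul_dvd_mul_right (pow_dvd_pow p hlt) u) dvd_rfl))
  have hji : j ≤ max i α := hpow _ _ ((Dvd.intro _ rfl).trans (hnm.trans (Nat.lcm_dvd
    (Nat.mul_dvd_mul_right (pow_dvd_pow p (le_max_left i α)) u)
    ((pow_dvd_pow p (le_max_right i α)).mul_right u))))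
  rcases hlt.eq_or_lt with rfl | hlt
  · exact Or.inl ⟨rfl, hαj⟩
  · obtain rfl : α = j := by omega
    refine Or.inr ⟨hlt, ?_⟩
    rw [← mul_assoc, ← pow_add, Nat.sub_add_cancel hlt.le]

theorem orderOf_eq_pow_mul_of_orderOf_mul_eq_prime_pow {G : Type*} [CommGroup G] [Finite G]
    {p α : ℕ} (hp : p.Prime) {x y : G} (hxy : orderOf (x * y) = p ^ α)
    (hlt : padicValNat p (orderOf x) ≤ padicValNat p (orderOf y)) :
    (orderOf x = orderOf y ∧ α ≤ padicValNat p (orderOf x)) ∨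
      (padicValNat p (orderOf x) < α ∧
        orderOf y = p ^ (α - padicValNat p (orderOf x)) * orderOf x) := by
  refine Nat.eq_pow_mul_of_dvd_lcm_prime_pow hp (orderOf_pos x).ne' (orderOf_pos y).ne' ?_ ?_ ?_ hlt
  · have h := (Commute.all x⁻¹ (x * y)).orderOf_mul_dvd_lcm
    rwa [inv_mul_cancel_left, orderOf_inv, hxy] at h
  · have h := (Commute.all y⁻¹ (x * y)).orderOf_mul_dvd_lcm
    rwa [mul_comm x y, inv_mul_cancel_left, orderOf_inv, mul_comm y x, hxy] at h
  · rw [← hxy]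
    exact (Commute.all x y).orderOf_mul_dvd_lcm

section Companion

variable {F : Type*} [Field F]

theorem companion_pow_mulVec_eigenvector {a b γ : F} (h : a * γ + b = γ ^ 2) (n : ℕ) :
    !![a, b; 1, 0] ^ n *ᵥ ![γ, 1] = γ ^ n • ![γ, 1] := by
  induction n with
  | zero => simp
  | succ n ih =>
    rw [pow_succ, ← Matrix.mulVec_mulVec]
    have : !![a, b; 1, 0] *ᵥ ![γ, 1] = γ • ![γ, 1] := by
      ext i
      fin_cases i
      · simpa [Matrix.mulVec, dotProduct, pow_two] using h
      · simp [Matrix.mulVec, dotProduct]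
    rw [this, Matrix.mulVec_smul, ih, smul_smul, pow_succ']

theorem companion_pow_mulVec_eq_self_iff_s10 {γ₁ γ₂ : F} (hne : γ₁ ≠ γ₂) (s t : F) (n : ℕ) :
    !![γ₁ + γ₂, -(γ₁ * γ₂); 1, 0] ^ n *ᵥ (s • ![γ₁, 1] + t • ![γ₂, 1]) =
        s • ![γ₁, 1] + t • ![γ₂, 1] ↔
      (s = 0 ∨ γ₁ ^ n = 1) ∧ (t = 0 ∨ γ₂ ^ n = 1) := by
  rw [Matrix.mulVec_add, Matrix.mulVec_smul, Matrix.mulVec_smul,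
    companion_pow_mulVec_eigenvector (by ring), companion_pow_mulVec_eigenvector (by ring)]
  constructor
  · intro h
    have h0 := congrFun h 0
    have h1 := congrFun h 1
    simp at h0 h1
    have hs : (γ₁ - γ₂) * (s * (γ₁ ^ n - 1)) = 0 := by linear_combination h0 - γ₂ * h1
    have ht : (γ₁ - γ₂) * (t * (γ₂ ^ n - 1)) = 0 := by linear_combination γ₁ * h1 - h0
    simpa [sub_ne_zero.2 hne, sub_eq_zero] using And.intro hs ht
  · rintro ⟨rfl | h₁, rfl | h₂⟩ <;> simp [*]

theorem isLeast_orbit_of_dvd_iff {γ₁ γ₂ : F} (hne : γ₁ ≠ γ₂) {s t : F} {d : ℕ}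
    (hd : 0 < d) (h : ∀ n, ((s = 0 ∨ γ₁ ^ n = 1) ∧ (t = 0 ∨ γ₂ ^ n = 1)) ↔ d ∣ n) :
    IsLeast {n : ℕ | 0 < n ∧ !![γ₁ + γ₂, -(γ₁ * γ₂); 1, 0] ^ n *ᵥ
      (s • ![γ₁, 1] + t • ![γ₂, 1]) = s • ![γ₁, 1] + t • ![γ₂, 1]} d := by
  simp only [companion_pow_mulVec_eq_self_iff_s10 hne, h]
  exact ⟨⟨hd, dvd_rfl⟩, fun n hn => Nat.le_of_dvd hn.1 hn.2⟩

theorem exists_eq_smul_add_smul {γ₁ γ₂ : F} (hne : γ₁ ≠ γ₂) (v : Fin 2 → F) :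
    ∃ s t : F, v = s • ![γ₁, 1] + t • ![γ₂, 1] := by
  have hne' := sub_ne_zero.2 hne
  refine ⟨(v 0 - γ₂ * v 1) / (γ₁ - γ₂), (γ₁ * v 1 - v 0) / (γ₁ - γ₂), ?_⟩
  ext i
  fin_cases i
  · simp
    field_simp
    ring
  · simp
    field_simp
    ring

/-- The orbit lengths of a companion matrix with distinct nonzero eigenvalues, the order of the
first of which divides the order of the second. -/
theorem companion_orbit_lengths {γ₁ γ₂ : F} (hne : γ₁ ≠ γ₂) (h₁ : 0 < orderOf γ₁)
    (h₂ : 0 < orderOf γ₂) (hdvd : orderOf γ₁ ∣ orderOf γ₂) :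
    (∀ v : Fin 2 → F, v ≠ 0 →
      IsLeast {n : ℕ | 0 < n ∧ !![γ₁ + γ₂, -(γ₁ * γ₂); 1, 0] ^ n *ᵥ v = v} (orderOf γ₁) ∨
      IsLeast {n : ℕ | 0 < n ∧ !![γ₁ + γ₂, -(γ₁ * γ₂); 1, 0] ^ n *ᵥ v = v} (orderOf γ₂)) ∧
    (∃ v : Fin 2 → F, v ≠ 0 ∧
      IsLeast {n : ℕ | 0 < n ∧ !![γ₁ + γ₂, -(γ₁ * γ₂); 1, 0] ^ n *ᵥ v = v} (orderOf γ₁)) ∧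
    (∃ v : Fin 2 → F, v ≠ 0 ∧
      IsLeast {n : ℕ | 0 < n ∧ !![γ₁ + γ₂, -(γ₁ * γ₂); 1, 0] ^ n *ᵥ v = v} (orderOf γ₂)) := by
  refine ⟨fun v hv => ?_, ⟨(1 : F) • ![γ₁, 1] + (0 : F) • ![γ₂, 1], fun h => ?_,
    isLeast_orbit_of_dvd_iff hne h₁ fun n => by simp [orderOf_dvd_iff_pow_eq_one]⟩,
    ⟨(0 : F) • ![γ₁, 1] + (1 : F) • ![γ₂, 1], fun h => ?_,
    isLeast_orbit_of_dvd_iff hne h₂ fun n => by simp [orderOf_dvd_iff_pow_eq_one]⟩⟩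
  · obtain ⟨s, t, rfl⟩ := exists_eq_smul_add_smul hne v
    by_cases ht : t = 0
    · have hs : s ≠ 0 := by
        rintro rfl
        simp [ht] at hv
      exact Or.inl (isLeast_orbit_of_dvd_iff hne h₁ fun n => by
        simp [hs, ht, orderOf_dvd_iff_pow_eq_one])
    · refine Or.inr (isLeast_orbit_of_dvd_iff hne h₂ fun n => ?_)
      simp only [ht, false_or, ← orderOf_dvd_iff_pow_eq_one]
      exact ⟨And.right, fun h => ⟨Or.inr (hdvd.trans h), h⟩⟩
  · simpa using congrFun h 1
  · simpa using congrFun h 1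

end Companion

/-- if `Q = !![a, b; 1, 0]` has distinct roots over `𝔽_q` and
`ord(-b) = p^α` for a prime `p` and `α ≥ 1`, then exactly one of the following holds:
(a) there is `l > 0` with `v_p(l) ≥ α` such that every nonzero vector has orbit length `l`;
(b) there is `l > 0` with `k = v_p(l) < α` such that every nonzero vector has orbit
length `l` or `p^(α-k)·l`, and both lengths occur. -/
theorem orbit_lengths_prime_pow_order {F : Type*} [Field F] [Fintype F]
    (a b : F) (hb : b ≠ 0)
    (Q : Matrix (Fin 2) (Fin 2) F) (hQ : Q = !![a, b; 1, 0])
    (γ₁ γ₂ : F) (hne : γ₁ ≠ γ₂) (hsum : γ₁ + γ₂ = a) (hprod : γ₁ * γ₂ = -b)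
    (p α : ℕ) (hp : p.Prime) (hα : 0 < α) (hr : orderOf (-b) = p ^ α) :
    Xor'
      (∃ l : ℕ, 0 < l ∧ α ≤ padicValNat p l ∧ ∀ v : Fin 2 → F, v ≠ 0 →
        IsLeast {n : ℕ | 0 < n ∧ Q ^ n *ᵥ v = v} l)
      (∃ l : ℕ, 0 < l ∧ padicValNat p l < α ∧
        (∀ v : Fin 2 → F, v ≠ 0 →
          IsLeast {n : ℕ | 0 < n ∧ Q ^ n *ᵥ v = v} l ∨
          IsLeast {n : ℕ | 0 < n ∧ Q ^ n *ᵥ v = v} (p ^ (α - padicValNat p l) * l)) ∧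
        (∃ v : Fin 2 → F, v ≠ 0 ∧ IsLeast {n : ℕ | 0 < n ∧ Q ^ n *ᵥ v = v} l) ∧
        (∃ v : Fin 2 → F, v ≠ 0 ∧
          IsLeast {n : ℕ | 0 < n ∧ Q ^ n *ᵥ v = v} (p ^ (α - padicValNat p l) * l))) := by
  subst hQ
  obtain rfl : b = -(γ₁ * γ₂) := by rw [hprod, neg_neg]
  subst hsum
  rw [neg_neg] at hr
  refine (xor_iff_or_and_not_and _ _).2 ⟨?_, ?_⟩
  · wlog hle : padicValNat p (orderOf γ₁) ≤ padicValNat p (orderOf γ₂) generalizing γ₁ γ₂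
    · have := this γ₂ γ₁ hne.symm (by rwa [mul_comm]) (by ring) (by rwa [mul_comm])
        (le_of_not_ge hle)
      rwa [add_comm γ₂, mul_comm γ₂] at this
    have hmul : γ₁ * γ₂ ≠ 0 := fun h => hb (by rw [h, neg_zero])
    obtain ⟨x, rfl⟩ : ∃ x : Fˣ, (x : F) = γ₁ := ⟨Units.mk0 γ₁ (left_ne_zero_of_mul hmul), rfl⟩
    obtain ⟨y, rfl⟩ : ∃ y : Fˣ, (y : F) = γ₂ := ⟨Units.mk0 γ₂ (right_ne_zero_of_mul hmul), rfl⟩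
    have hx : 0 < orderOf (x : F) := by rw [orderOf_units]; exact orderOf_pos x
    have hy : 0 < orderOf (y : F) := by rw [orderOf_units]; exact orderOf_pos y
    have hord := orderOf_eq_pow_mul_of_orderOf_mul_eq_prime_pow hp (x := x) (y := y)
      (by rw [← orderOf_units, Units.val_mul, hr]) (by simpa only [orderOf_units] using hle)
    simp only [← orderOf_units] at hord
    rcases hord with ⟨heq, hle⟩ | ⟨hlt, heq⟩
    · have h := (companion_orbit_lengths hne hx hy heq.dvd).1
      simp only [← heq, or_self] at h
      exact Or.inl ⟨_, hx, hle, h⟩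
    · have h := companion_orbit_lengths hne hx hy (Dvd.intro_left _ heq.symm)
      rw [heq] at h
      exact Or.inr ⟨_, hx, hlt, h⟩
  · rintro ⟨⟨m, -, -, hm⟩, l, hl, hlt, -, ⟨v, hv, hvl⟩, w, hw, hwl⟩
    obtain rfl := hvl.unique (hm v hv)
    exact (hwl.unique (hm w hw)).not_gt
      (lt_mul_of_one_lt_left hl (Nat.one_lt_pow (Nat.sub_ne_zero_of_lt hlt) hp.one_lt))
end

section
/- Suppose the characteristic polynomial p(x) = x² − a·x − b of Q has two distinct roots γ₁, γ₂ in 𝔽_q with ord(γ₁) = l and ord(γ₂) = k·l for a positive integer k > 1. Then the action of the cyclic group generated by Q on the nonzero vectors of 𝔽_q² has exactly (q−1)/l orbits of cardinality l and exactly q(q−1)/(k·l) orbits of cardinality k·l, and the total number of nontrivial orbits equals (q−1)(q+k)/(k·l). -/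
open Matrix

open Function in
theorem ncard_range_iterate {α : Type*} (f : α → α) (v : α) (hv : 0 < minimalPeriod f v) :
    (Set.range fun i : ℕ => f^[i] v).ncard = minimalPeriod f v := by
  have h : (Set.range fun i : ℕ => f^[i] v) =
      (fun i : ℕ => f^[i] v) '' Set.Iio (minimalPeriod f v) := by
    ext w
    constructor
    · rintro ⟨i, rfl⟩
      exact ⟨i % minimalPeriod f v, Nat.mod_lt _ hv, iterate_mod_minimalPeriod_eq⟩
    · rintro ⟨i, -, rfl⟩
      exact ⟨i, rfl⟩
  rw [h, Set.InjOn.ncard_image iterate_injOn_Iio_minimalPeriod, Set.ncard_eq_toFinset_card']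
  simp

open Function in
theorem range_iterate_eq_of_mem {α : Type*} (f : α → α) {v w : α} (hv : 0 < minimalPeriod f v)
    (hw : w ∈ Set.range fun i : ℕ => f^[i] v) :
    (Set.range fun i : ℕ => f^[i] w) = Set.range fun i : ℕ => f^[i] v := by
  obtain ⟨j, rfl⟩ := hw
  ext u
  constructor
  · rintro ⟨i, rfl⟩
    exact ⟨i + j, iterate_add_apply f i j v⟩
  · rintro ⟨i, rfl⟩
    refine ⟨i + (minimalPeriod f v * j - j), ?_⟩
    have hj : j ≤ minimalPeriod f v * j := Nat.le_mul_of_pos_left j hv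
    have hper : f^[minimalPeriod f v * j] v = v :=
      (isPeriodicPt_minimalPeriod f v).mul_const j
    change f^[_] (f^[j] v) = f^[i] v
    rw [← iterate_add_apply, add_assoc, Nat.sub_add_cancel hj, iterate_add_apply, hper]

open Function in
/-- A finite invariant set all of whose points have minimal period `n` is partitioned into orbits
of size `n`. -/
theorem ncard_orbits_mul_minimalPeriod {α : Type*} [Finite α] (f : α → α) (A : Set α) (n : ℕ)
    (hn : 0 < n) (hA : ∀ v ∈ A, f v ∈ A) (hper : ∀ v ∈ A, minimalPeriod f v = n) :
    {S : Set α | ∃ v ∈ A, S = Set.range fun i : ℕ => f^[i] v}.ncard * n = A.ncard := by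
  classical
  have := Fintype.ofFinite α
  have hiter : ∀ v ∈ A, ∀ i : ℕ, f^[i] v ∈ A := by
    intro v hv i
    induction i with
    | zero => exact hv
    | succ i ih => rw [iterate_succ_apply']; exact hA _ ih
  have hset : {S : Set α | ∃ v ∈ A, S = Set.range fun i : ℕ => f^[i] v} =
      ((A.toFinset.image fun v => Set.range fun i : ℕ => f^[i] v : Finset (Set α)) :
        Set (Set α)) := by
    ext S
    simp [eq_comm]
  rw [hset, Set.ncard_coe_finset, Set.ncard_eq_toFinset_card' A,
    Finset.card_eq_sum_card_image (fun v => Set.range fun i : ℕ => f^[i] v) A.toFinset]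
  symm
  apply Finset.sum_const_nat
  intro S hS
  obtain ⟨v, hv, rfl⟩ := Finset.mem_image.1 hS
  rw [Set.mem_toFinset] at hv
  have hpos : 0 < minimalPeriod f v := by rwa [hper v hv]
  rw [← hper v hv, ← ncard_range_iterate f v hpos, ← Set.ncard_coe_finset]
  congr 1
  ext w
  simp only [Finset.coe_filter, Set.mem_toFinset, Set.mem_ofPred_eq]
  constructor
  · rintro ⟨-, h⟩
    rw [← h]
    exact ⟨0, rfl⟩
  · intro hw
    refine ⟨?_, range_iterate_eq_of_mem f hpos hw⟩
    obtain ⟨i, rfl⟩ := hw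
    exact hiter v hv i

theorem mulVec_pow_eq_iterate {R : Type*} [CommSemiring R] {m : Type*} [Fintype m] [DecidableEq m]
    (Q : Matrix m m R) (n : ℕ) (v : m → R) : Q ^ n *ᵥ v = (fun w => Q *ᵥ w)^[n] v := by
  induction n with
  | zero => simp
  | succ n ih => rw [Function.iterate_succ_apply', ← ih, pow_succ', Matrix.mulVec_mulVec]

/-- A vector is fixed by the `n`-th iterate of a companion matrix with distinct eigenvalues iff
each of its nonzero eigencoordinates has an eigenvalue whose `n`-th power is `1`. -/
theorem isPeriodicPt_companion_iff {F : Type*} [Field F] {a b γ₁ γ₂ : F} (hne : γ₁ ≠ γ₂)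
    (hsum : γ₁ + γ₂ = a) (hprod : γ₁ * γ₂ = -b) (n : ℕ) (v : Fin 2 → F) :
    Function.IsPeriodicPt (fun w => !![a, b; 1, 0] *ᵥ w) n v ↔
      (v 0 - γ₂ * v 1 = 0 ∨ γ₁ ^ n = 1) ∧ (v 0 - γ₁ * v 1 = 0 ∨ γ₂ ^ n = 1) := by
  have hb : b = -(γ₁ * γ₂) := by rw [hprod, neg_neg]
  subst hsum hb
  set f : (Fin 2 → F) → (Fin 2 → F) := fun w => !![γ₁ + γ₂, -(γ₁ * γ₂); 1, 0] *ᵥ w with hf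
  have h₁ : ∀ m : ℕ, (f^[m] v) 0 - γ₂ * (f^[m] v) 1 = γ₁ ^ m * (v 0 - γ₂ * v 1) := by
    intro m
    induction m with
    | zero => simp
    | succ m ih =>
      rw [Function.iterate_succ_apply', pow_succ', mul_assoc, ← ih]
      simp [hf, dotProduct, Fin.sum_univ_two]
      ring
  have h₂ : ∀ m : ℕ, (f^[m] v) 0 - γ₁ * (f^[m] v) 1 = γ₂ ^ m * (v 0 - γ₁ * v 1) := by
    intro m
    induction m with
    | zero => simp
    | succ m ih =>
      rw [Function.iterate_succ_apply', pow_succ', mul_assoc, ← ih]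
      simp [hf, dotProduct, Fin.sum_univ_two]
      ring
  have hext : ∀ w : Fin 2 → F, w = v ↔
      w 0 - γ₂ * w 1 = v 0 - γ₂ * v 1 ∧ w 0 - γ₁ * w 1 = v 0 - γ₁ * v 1 := by
    intro w
    refine ⟨fun h => by simp [h], fun ⟨e₁, e₂⟩ => ?_⟩
    have e : w 1 = v 1 :=
      mul_left_cancel₀ (sub_ne_zero.2 hne) (by linear_combination e₁ - e₂)
    rw [e] at e₁
    have e' : w 0 = v 0 := by linear_combination e₁
    ext i
    fin_cases i
    · exact e'
    · exact e
  change f^[n] v = v ↔ _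
  rw [hext, h₁, h₂, mul_left_eq_self₀, mul_left_eq_self₀, or_comm, or_comm (a := γ₂ ^ n = 1)]

/-- suppose `Q = !![a, b; 1, 0]` has distinct roots `γ₁, γ₂` over `𝔽_q`
with `ord(γ₁) = l` and `ord(γ₂) = k·l`, `k > 1`. Then there are exactly `(q-1)/l`
orbits of cardinality `l`, exactly `q(q-1)/(k·l)` orbits of cardinality `k·l`, and
the total number of nontrivial orbits is `(q-1)(q+k)/(k·l)`. -/
theorem number_of_orbits_distinct_roots {F : Type*} [Field F] [Fintype F]
    (a b : F) (hb : b ≠ 0)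
    (Q : Matrix (Fin 2) (Fin 2) F) (hQ : Q = !![a, b; 1, 0])
    (γ₁ γ₂ : F) (hne : γ₁ ≠ γ₂) (hsum : γ₁ + γ₂ = a) (hprod : γ₁ * γ₂ = -b)
    (l k : ℕ) (hl : orderOf γ₁ = l) (hk : 1 < k) (hkl : orderOf γ₂ = k * l)
    (q : ℕ) (hq : q = Fintype.card F) :
    {S : Set (Fin 2 → F) | ∃ v : Fin 2 → F, v ≠ 0 ∧
        S = Set.range (fun n : ℕ => Q ^ n *ᵥ v) ∧ S.ncard = l}.ncard = (q - 1) / l ∧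
    {S : Set (Fin 2 → F) | ∃ v : Fin 2 → F, v ≠ 0 ∧
        S = Set.range (fun n : ℕ => Q ^ n *ᵥ v) ∧ S.ncard = k * l}.ncard
      = q * (q - 1) / (k * l) ∧
    {S : Set (Fin 2 → F) | ∃ v : Fin 2 → F, v ≠ 0 ∧
        S = Set.range (fun n : ℕ => Q ^ n *ᵥ v)}.ncard
      = (q - 1) * (q + k) / (k * l) := by
  have hγ₁ : γ₁ ≠ 0 := by
    rintro rfl
    exact hb (by simpa using hprod.symm)
  have hγ₂ : γ₂ ≠ 0 := by
    rintro rfl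
    exact hb (by simpa using hprod.symm)
  have hlpos : 0 < l := by
    rw [← hl, orderOf_pos_iff, isOfFinOrder_iff_pow_eq_one]
    exact ⟨_, Nat.sub_pos_of_lt Fintype.one_lt_card, FiniteField.pow_card_sub_one_eq_one γ₁ hγ₁⟩
  have hklpos : 0 < k * l := by positivity
  have hlkl : l ≠ k * l := by nlinarith
  set f : (Fin 2 → F) → (Fin 2 → F) := fun w => Q *ᵥ w with hf
  simp only [mulVec_pow_eq_iterate, ← hf]
  have hper : ∀ (n : ℕ) (v : Fin 2 → F), Function.IsPeriodicPt f n v ↔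
      (v 0 - γ₂ * v 1 = 0 ∨ l ∣ n) ∧ (v 0 - γ₁ * v 1 = 0 ∨ k * l ∣ n) := by
    intro n v
    rw [hf, hQ, isPeriodicPt_companion_iff hne hsum hprod, ← hkl, ← hl,
      orderOf_dvd_iff_pow_eq_one, orderOf_dvd_iff_pow_eq_one]
  set e : F → Fin 2 → F := fun t => ![γ₁ * t, t] with he
  have heinj : Function.Injective e := fun s t h => congrFun h 1
  have hrange : ∀ v : Fin 2 → F, v ∈ Set.range e ↔ v 0 - γ₁ * v 1 = 0 := by
    intro v
    constructor
    · rintro ⟨t, rfl⟩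
      simp [he]
    · intro h
      refine ⟨v 1, ?_⟩
      ext i
      fin_cases i
      · exact (sub_eq_zero.1 h).symm
      · rfl
  set A₁ : Set (Fin 2 → F) := e '' {0}ᶜ with hA₁
  set A₂ : Set (Fin 2 → F) := (Set.range e)ᶜ with hA₂
  have hmul : ∀ v, f v 0 - γ₁ * f v 1 = γ₂ * (v 0 - γ₁ * v 1) := by
    intro v
    simp only [hf, hQ, Matrix.mulVec, dotProduct, Fin.sum_univ_two]
    simp
    linear_combination -(v 0) * hsum + v 1 * hprod
  have hcard : A₁.ncard = q - 1 ∧ A₂.ncard = q * (q - 1) := by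
    constructor
    · rw [hA₁, Set.ncard_image_of_injective _ heinj, Set.ncard_compl, Set.ncard_singleton,
        Nat.card_eq_fintype_card, hq]
    · rw [hA₂, Set.ncard_compl, ← Set.image_univ, Set.ncard_image_of_injective _ heinj,
        Set.ncard_univ, Nat.card_eq_fintype_card, Nat.card_eq_fintype_card, hq]
      simp [pow_two, Nat.mul_sub]
  have hunion : ∀ v : Fin 2 → F, v ≠ 0 ↔ v ∈ A₁ ∨ v ∈ A₂ := by
    intro v
    have he0 : e 0 = 0 := by
      ext i
      fin_cases i <;> simp [he]
    by_cases hv : v ∈ Set.range e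
    · obtain ⟨t, rfl⟩ := hv
      simp [hA₁, hA₂, heinj.eq_iff, ← he0]
    · have : v ≠ 0 := by
        rintro rfl
        exact hv ⟨0, he0⟩
      exact iff_of_true this (Or.inr hv)
  have hper₁ : ∀ v ∈ A₁, Function.minimalPeriod f v = l := by
    rintro _ ⟨t, ht, rfl⟩
    have h : e t 0 - γ₂ * e t 1 ≠ 0 := by
      simpa [he, ← sub_mul, sub_eq_zero, hne] using ht
    refine Nat.dvd_right_iff_eq.1 fun n => ?_
    rw [← Function.isPeriodicPt_iff_minimalPeriod_dvd, hper]
    simp only [h, (hrange (e t)).1 ⟨t, rfl⟩, false_or, true_or, and_true]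
  have hper₂ : ∀ v ∈ A₂, Function.minimalPeriod f v = k * l := by
    intro v hv
    have h : v 0 - γ₁ * v 1 ≠ 0 := fun h => hv ((hrange v).2 h)
    refine Nat.dvd_right_iff_eq.1 fun n => ?_
    rw [← Function.isPeriodicPt_iff_minimalPeriod_dvd, hper]
    simp only [h, false_or]
    exact ⟨fun h => h.2, fun h => ⟨Or.inr ((Dvd.intro_left k rfl).trans h), h⟩⟩
  have hinv₂ : ∀ v ∈ A₂, f v ∈ A₂ := by
    intro v hv h
    rw [hrange, hmul, mul_eq_zero, or_iff_right hγ₂, ← hrange] at h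
    exact hv h
  have hinv₁ : ∀ v ∈ A₁, f v ∈ A₁ := by
    rintro _ ⟨t, ht, rfl⟩
    refine ⟨γ₁ * t, by simpa [hγ₁] using ht, ?_⟩
    ext i
    fin_cases i
    · simp [he, hf, hQ]
      linear_combination γ₁ * t * hsum - t * hprod
    · simp [he, hf, hQ]
  have hN₁ := ncard_orbits_mul_minimalPeriod f A₁ l hlpos hinv₁ hper₁
  have hN₂ := ncard_orbits_mul_minimalPeriod f A₂ (k * l) hklpos hinv₂ hper₂
  have hsize₁ : ∀ v ∈ A₁, (Set.range fun i : ℕ => f^[i] v).ncard = l := fun v hv => by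
    rw [ncard_range_iterate f v (by rwa [hper₁ v hv]), hper₁ v hv]
  have hsize₂ : ∀ v ∈ A₂, (Set.range fun i : ℕ => f^[i] v).ncard = k * l := fun v hv => by
    rw [ncard_range_iterate f v (by rwa [hper₂ v hv]), hper₂ v hv]
  set O₁ : Set (Set (Fin 2 → F)) := {S | ∃ v ∈ A₁, S = Set.range fun i : ℕ => f^[i] v} with hO₁
  set O₂ : Set (Set (Fin 2 → F)) := {S | ∃ v ∈ A₂, S = Set.range fun i : ℕ => f^[i] v} with hO₂
  have hS₁ : {S : Set (Fin 2 → F) | ∃ v : Fin 2 → F, v ≠ 0 ∧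
      S = Set.range (fun n : ℕ => f^[n] v) ∧ S.ncard = l} = O₁ := by
    ext S
    constructor
    · rintro ⟨v, hv, rfl, hS⟩
      rcases (hunion v).1 hv with h | h
      · exact ⟨v, h, rfl⟩
      · exact absurd (hS.symm.trans (hsize₂ v h)) hlkl
    · rintro ⟨v, hv, rfl⟩
      exact ⟨v, (hunion v).2 (Or.inl hv), rfl, hsize₁ v hv⟩
  have hS₂ : {S : Set (Fin 2 → F) | ∃ v : Fin 2 → F, v ≠ 0 ∧
      S = Set.range (fun n : ℕ => f^[n] v) ∧ S.ncard = k * l} = O₂ := by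
    ext S
    constructor
    · rintro ⟨v, hv, rfl, hS⟩
      rcases (hunion v).1 hv with h | h
      · exact absurd ((hsize₁ v h).symm.trans hS) hlkl
      · exact ⟨v, h, rfl⟩
    · rintro ⟨v, hv, rfl⟩
      exact ⟨v, (hunion v).2 (Or.inr hv), rfl, hsize₂ v hv⟩
  have hS : {S : Set (Fin 2 → F) | ∃ v : Fin 2 → F, v ≠ 0 ∧
      S = Set.range (fun n : ℕ => f^[n] v)} = O₁ ∪ O₂ := by
    ext S
    simp only [hunion, hO₁, hO₂, Set.mem_ofPred_eq, Set.mem_union, or_and_right, exists_or]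
  have hdisj : Disjoint O₁ O₂ := by
    rw [Set.disjoint_left]
    rintro S ⟨v, hv, rfl⟩ ⟨w, hw, h⟩
    exact hlkl ((hsize₁ v hv).symm.trans (h ▸ hsize₂ w hw))
  rw [hcard.1] at hN₁
  rw [hcard.2] at hN₂
  rw [hS₁, hS₂, hS, Set.ncard_union_eq hdisj]
  refine ⟨(Nat.div_eq_of_eq_mul_left hlpos hN₁.symm).symm,
    (Nat.div_eq_of_eq_mul_left hklpos hN₂.symm).symm,
    (Nat.div_eq_of_eq_mul_left hklpos ?_).symm⟩
  calc (q - 1) * (q + k) = k * (q - 1) + q * (q - 1) := by ring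
    _ = (O₁.ncard + O₂.ncard) * (k * l) := by rw [← hN₂, ← hN₁]; ring
end

section
/- Suppose the characteristic polynomial p(x) = x² − a·x − b of Q has two distinct roots γ₁, γ₂ in 𝔽_q and that ord(−b) is a prime power. Then both γ₁ and γ₂ are generators of the multiplicative group 𝔽_q^× if and only if the cyclic group generated by Q has exactly q + 1 orbits on the nonzero vectors of 𝔽_q². -/
open Matrix

/-- The forward orbit of `x` under iteration of `f`. -/
def forwardOrbit {α : Type*} (f : α → α) (x : α) : Set α := Set.range fun n : ℕ => f^[n] x

section ForwardOrbit

open Function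

variable {α β : Type*} {f : α → α} {g : β → β}

theorem mem_forwardOrbit_self (f : α → α) (x : α) : x ∈ forwardOrbit f x := ⟨0, rfl⟩

theorem forwardOrbit_subset {T : Set α} (hT : Set.MapsTo f T T) {x : α} (hx : x ∈ T) :
    forwardOrbit f x ⊆ T := by
  rintro _ ⟨n, rfl⟩
  exact hT.iterate n hx

theorem forwardOrbit_subset_of_mem {x y : α} (h : y ∈ forwardOrbit f x) :
    forwardOrbit f y ⊆ forwardOrbit f x := by
  obtain ⟨n, rfl⟩ := h
  rintro _ ⟨k, rfl⟩
  exact ⟨k + n, iterate_add_apply f k n x⟩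

theorem mem_forwardOrbit_symm [Finite α] (hf : Injective f) {x y : α}
    (h : y ∈ forwardOrbit f x) : x ∈ forwardOrbit f y := by
  obtain ⟨n, rfl⟩ := h
  obtain ⟨k, hk, hx⟩ := hf.mem_periodicPts x
  refine ⟨k * n - n, ?_⟩
  change f^[k * n - n] (f^[n] x) = x
  rw [← iterate_add_apply, Nat.sub_add_cancel (Nat.le_mul_of_pos_left n hk)]
  exact hx.mul_const n

theorem forwardOrbit_eq_iff [Finite α] (hf : Injective f) {x y : α} :
    forwardOrbit f y = forwardOrbit f x ↔ y ∈ forwardOrbit f x :=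
  ⟨fun h => h ▸ mem_forwardOrbit_self f y, fun h =>
    (forwardOrbit_subset_of_mem h).antisymm
      (forwardOrbit_subset_of_mem (mem_forwardOrbit_symm hf h))⟩

theorem ncard_forwardOrbit [Finite α] (hf : Injective f) (x : α) :
    (forwardOrbit f x).ncard = minimalPeriod f x := by
  have h : forwardOrbit f x = (f^[·] x) '' Set.Iio (minimalPeriod f x) := by
    ext y
    constructor
    · rintro ⟨n, rfl⟩
      exact ⟨n % minimalPeriod f x,
        Nat.mod_lt _ (minimalPeriod_pos_of_mem_periodicPts (hf.mem_periodicPts x)),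
        iterate_mod_minimalPeriod_eq⟩
    · rintro ⟨n, -, rfl⟩
      exact ⟨n, rfl⟩
  rw [h, iterate_injOn_Iio_minimalPeriod.ncard_image, Set.ncard_eq_toFinset_card']
  simp

theorem ncard_image_forwardOrbit_mul [Finite α] (hf : Injective f) {T : Set α}
    (hT : Set.MapsTo f T T) {k : ℕ} (hk : ∀ x ∈ T, minimalPeriod f x = k) :
    (forwardOrbit f '' T).ncard * k = T.ncard := by
  classical
  have := Fintype.ofFinite α
  rw [Set.ncard_eq_toFinset_card' T, Finset.card_eq_sum_card_image (forwardOrbit f) T.toFinset,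
    Finset.sum_const_nat (m := k), ← Set.toFinset_image, ← Set.ncard_eq_toFinset_card']
  intro S hS
  simp only [Finset.mem_image, Set.mem_toFinset] at hS
  obtain ⟨x, hx, rfl⟩ := hS
  rw [← hk x hx, ← ncard_forwardOrbit hf x, ← Set.ncard_coe_finset]
  congr 1
  ext y
  simp only [Finset.coe_filter, Set.mem_toFinset, Set.mem_ofPred_eq, forwardOrbit_eq_iff hf,
    and_iff_right_iff_imp]
  exact fun h => forwardOrbit_subset hT hx h

theorem disjoint_image_forwardOrbit {S T : Set α} (hT : Set.MapsTo f T T) (h : Disjoint S T) :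
    Disjoint (forwardOrbit f '' S) (forwardOrbit f '' T) := by
  rw [Set.disjoint_left]
  rintro _ ⟨x, hx, rfl⟩ ⟨y, hy, hxy⟩
  exact Set.disjoint_left.1 h hx
    (forwardOrbit_subset hT hy (hxy ▸ mem_forwardOrbit_self f x))

theorem Function.Semiconj.ncard_image_forwardOrbit {e : α → β} (h : Semiconj e f g)
    (he : Injective e) (T : Set α) :
    (forwardOrbit g '' (e '' T)).ncard = (forwardOrbit f '' T).ncard := by
  rw [← Set.ncard_image_of_injective _ (Set.image_injective.2 he), Set.image_image,
    Set.image_image]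
  congr 1
  refine Set.image_congr fun x _ => ?_
  rw [forwardOrbit, forwardOrbit, ← Set.range_comp]
  exact congrArg Set.range (funext fun n => ((h.iterate_right n) x).symm)

end ForwardOrbit

section Scaling

open Function

variable {F : Type*} [Field F]

theorem minimalPeriod_mul_left_of_ne_zero (c : F) {x : F} (hx : x ≠ 0) :
    minimalPeriod (c * ·) x = orderOf c := by
  rw [orderOf, minimalPeriod_eq_minimalPeriod_iff]
  intro n
  simp [IsPeriodicPt, IsFixedPt, hx]

theorem minimalPeriod_mul_left_zero (c : F) : minimalPeriod (c * ·) (0 : F) = 1 :=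
  minimalPeriod_eq_one_iff_isFixedPt.2 (mul_zero c)

theorem orderOf_dvd_fintypeCard_sub_one [Fintype F] {c : F} (hc : c ≠ 0) :
    orderOf c ∣ Fintype.card F - 1 :=
  orderOf_dvd_of_pow_eq_one (FiniteField.pow_card_sub_one_eq_one c hc)

theorem ncard_compl_singleton_zero [Fintype F] :
    ({0}ᶜ : Set F).ncard = Fintype.card F - 1 := by
  rw [Set.ncard_compl, Set.ncard_singleton, Nat.card_eq_fintype_card]

/-- The number of orbits of `(x, y) ↦ (c * x, d * y)` on the nonzero vectors, split according to
whether the second, the first or no coordinate vanishes. -/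
theorem exists_ncard_image_forwardOrbit_prodMap [Fintype F] {c d : F} (hc : c ≠ 0) (hd : d ≠ 0) :
    ∃ A B C : ℕ, A * orderOf c = Fintype.card F - 1 ∧ B * orderOf d = Fintype.card F - 1 ∧
      C * (orderOf c).lcm (orderOf d) = (Fintype.card F - 1) * (Fintype.card F - 1) ∧
      (forwardOrbit (Prod.map (c * ·) (d * ·)) '' {0}ᶜ).ncard = A + B + C := by
  set g : F × F → F × F := Prod.map (c * ·) (d * ·) with hg
  have hinj : Injective g := (mul_right_injective₀ hc).prodMap (mul_right_injective₀ hd)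
  set X : Set (F × F) := {0}ᶜ ×ˢ {0}
  set Y : Set (F × F) := {0} ×ˢ {0}ᶜ
  set Z : Set (F × F) := {0}ᶜ ×ˢ {0}ᶜ
  have hX : Set.MapsTo g X X := by rintro ⟨x, y⟩ h; simpa [g, X, hc, hd] using h
  have hY : Set.MapsTo g Y Y := by rintro ⟨x, y⟩ h; simpa [g, Y, hc, hd] using h
  have hZ : Set.MapsTo g Z Z := by rintro ⟨x, y⟩ h; simpa [g, Z, hc, hd] using h
  have hunion : ({0}ᶜ : Set (F × F)) = X ∪ Y ∪ Z := by
    ext ⟨x, y⟩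
    by_cases hx : x = 0 <;> by_cases hy : y = 0 <;> simp [X, Y, Z, hx, hy]
  have hXY : Disjoint X Y := by
    rw [Set.disjoint_left]; rintro ⟨x, y⟩ h h'; simp_all [X, Y]
  have hXYZ : Disjoint (X ∪ Y) Z := by
    rw [Set.disjoint_left]; rintro ⟨x, y⟩ h h'; simp_all [X, Y, Z]
  refine ⟨(forwardOrbit g '' X).ncard, (forwardOrbit g '' Y).ncard,
    (forwardOrbit g '' Z).ncard, ?_, ?_, ?_, ?_⟩
  · rw [ncard_image_forwardOrbit_mul hinj hX, Set.ncard_prod, ncard_compl_singleton_zero,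
      Set.ncard_singleton, mul_one]
    rintro ⟨x, y⟩ ⟨hx, rfl⟩
    rw [hg, minimalPeriod_prodMap, minimalPeriod_mul_left_of_ne_zero c hx,
      minimalPeriod_mul_left_zero, Nat.lcm_one_right]
  · rw [ncard_image_forwardOrbit_mul hinj hY, Set.ncard_prod, ncard_compl_singleton_zero,
      Set.ncard_singleton, one_mul]
    rintro ⟨x, y⟩ ⟨rfl, hy⟩
    rw [hg, minimalPeriod_prodMap, minimalPeriod_mul_left_of_ne_zero d hy,
      minimalPeriod_mul_left_zero, Nat.lcm_one_left]
  · rw [ncard_image_forwardOrbit_mul hinj hZ, Set.ncard_prod, ncard_compl_singleton_zero]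
    rintro ⟨x, y⟩ ⟨hx, hy⟩
    rw [hg, minimalPeriod_prodMap, minimalPeriod_mul_left_of_ne_zero c hx,
      minimalPeriod_mul_left_of_ne_zero d hy]
  · rw [hunion, Set.image_union, Set.ncard_union_eq, Set.image_union, Set.ncard_union_eq]
    · exact disjoint_image_forwardOrbit hY hXY
    · exact disjoint_image_forwardOrbit hZ hXYZ

end Scaling

theorem eq_and_eq_iff_add_eq {A B C N m n : ℕ} (hN : 0 < N) (hA : A * m = N) (hB : B * n = N)
    (hC : C * m.lcm n = N * N) : m = N ∧ n = N ↔ A + B + C = N + 2 := by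
  have hm : m ∣ N := ⟨A, by rw [mul_comm, hA]⟩
  have hn : n ∣ N := ⟨B, by rw [mul_comm, hB]⟩
  obtain ⟨c, hc⟩ := Nat.lcm_dvd hm hn
  have hL : 0 < m.lcm n := Nat.pos_of_dvd_of_pos (Nat.lcm_dvd hm hn) hN
  have hCc : C = N * c := Nat.eq_of_mul_eq_mul_right hL (by rw [hC]; nth_rewrite 2 [hc]; ring)
  have hA0 : 0 < A := Nat.pos_of_ne_zero (by rintro rfl; omega)
  have hB0 : 0 < B := Nat.pos_of_ne_zero (by rintro rfl; omega)
  have hc0 : 0 < c := Nat.pos_of_ne_zero (by rintro rfl; omega)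
  constructor
  · rintro ⟨rfl, rfl⟩
    have hA1 : A = 1 := Nat.eq_of_mul_eq_mul_right hN (by omega)
    have hB1 : B = 1 := Nat.eq_of_mul_eq_mul_right hN (by omega)
    have hC1 : C = n := Nat.eq_of_mul_eq_mul_right hN (by simpa using hC)
    omega
  · intro h
    have : N ≤ N * c := Nat.le_mul_of_pos_right N hc0
    obtain rfl : A = 1 := by omega
    obtain rfl : B = 1 := by omega
    omega

theorem Matrix.iterate_mulVec {n R : Type*} [Fintype n] [DecidableEq n] [Semiring R]
    (M : Matrix n n R) (k : ℕ) (v : n → R) : (M *ᵥ ·)^[k] v = M ^ k *ᵥ v := by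
  induction k with
  | zero => simp
  | succ k ih => rw [Function.iterate_succ_apply', ih, mulVec_mulVec, pow_succ']

/-- The two left eigenvectors of `!![c + d, -(c * d); 1, 0]` as coordinates on the plane. -/
def companionCoordinates {F : Type*} [Field F] (c d : F) (v : Fin 2 → F) : F × F :=
  (v 0 - d * v 1, v 0 - c * v 1)

theorem companionCoordinates_bijective {F : Type*} [Field F] {c d : F} (h : c ≠ d) :
    Function.Bijective (companionCoordinates c d) := by
  have hcd : c - d ≠ 0 := sub_ne_zero.2 h
  constructor
  · intro v w hvw
    obtain ⟨h₁, h₂⟩ := Prod.ext_iff.1 hvw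
    simp only [companionCoordinates] at h₁ h₂
    have h1 : v 1 = w 1 := mul_left_cancel₀ hcd (by linear_combination h₁ - h₂)
    ext i
    fin_cases i
    · change v 0 = w 0
      linear_combination h₁ + d * h1
    · exact h1
  · rintro ⟨x, y⟩
    refine ⟨![x + d * ((x - y) / (c - d)), (x - y) / (c - d)], ?_⟩
    ext
    · simp [companionCoordinates]
    · simp only [companionCoordinates, Matrix.cons_val_zero, Matrix.cons_val_one]
      field_simp
      ring

theorem companionCoordinates_semiconj {F : Type*} [Field F] (c d : F) :
    Function.Semiconj (companionCoordinates c d) (!![c + d, -(c * d); 1, 0] *ᵥ ·)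
      (Prod.map (c * ·) (d * ·)) := by
  intro v
  ext <;> simp [companionCoordinates, mulVec, dotProduct, Fin.sum_univ_two] <;> ring

/-- suppose `Q = !![a, b; 1, 0]` has distinct roots `γ₁, γ₂` over `𝔽_q`
and `ord(-b)` is a prime power. Then both `γ₁` and `γ₂` generate `𝔽_q^×`
(i.e. have order `q - 1`) iff the cyclic group generated by `Q` has exactly `q + 1`
orbits on the nonzero vectors of `𝔽_q²`. -/
theorem two_primitive_roots_iff {F : Type*} [Field F] [Fintype F]
    (a b : F) (hb : b ≠ 0)
    (Q : Matrix (Fin 2) (Fin 2) F) (hQ : Q = !![a, b; 1, 0])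
    (γ₁ γ₂ : F) (hne : γ₁ ≠ γ₂) (hsum : γ₁ + γ₂ = a) (hprod : γ₁ * γ₂ = -b)
    (hpp : IsPrimePow (orderOf (-b))) :
    (orderOf γ₁ = Fintype.card F - 1 ∧ orderOf γ₂ = Fintype.card F - 1) ↔
      {S : Set (Fin 2 → F) | ∃ v : Fin 2 → F, v ≠ 0 ∧
        S = Set.range (fun n : ℕ => Q ^ n *ᵥ v)}.ncard = Fintype.card F + 1 := by
  have hγ₁ : γ₁ ≠ 0 := by rintro rfl; exact hb (by simpa using hprod.symm)
  have hγ₂ : γ₂ ≠ 0 := by rintro rfl; exact hb (by simpa using hprod.symm)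
  obtain ⟨A, B, C, hA, hB, hC, hcard⟩ := exists_ncard_image_forwardOrbit_prodMap hγ₁ hγ₂
  have hq : 1 < Fintype.card F := Fintype.one_lt_card
  have hQ' : Q = !![γ₁ + γ₂, -(γ₁ * γ₂); 1, 0] := by rw [hQ, hsum, hprod, neg_neg]
  have hset : {S : Set (Fin 2 → F) | ∃ v : Fin 2 → F, v ≠ 0 ∧
      S = Set.range (fun n : ℕ => Q ^ n *ᵥ v)} = forwardOrbit (Q *ᵥ ·) '' {0}ᶜ := by
    ext S
    simp only [forwardOrbit, Matrix.iterate_mulVec, Set.mem_image, Set.mem_compl_iff,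
      Set.mem_singleton_iff, Set.mem_ofPred_eq, eq_comm (a := S)]
  have hbij := companionCoordinates_bijective hne
  have himage : companionCoordinates γ₁ γ₂ '' {0}ᶜ = {0}ᶜ := by
    have h0 : companionCoordinates γ₁ γ₂ 0 = 0 := by simp [companionCoordinates]
    rw [Set.image_compl_eq hbij, Set.image_singleton, h0]
  rw [hset, hQ', ← (companionCoordinates_semiconj γ₁ γ₂).ncard_image_forwardOrbit hbij.injective,
    himage, hcard, eq_and_eq_iff_add_eq (by omega) hA hB hC]
  omega
end

section
/- Let 𝔽_q have characteristic p and suppose the characteristic polynomial p(x) = x² − a·x − b of Q has a repeated root γ in 𝔽_q (i.e., a = 2γ and −b = γ²), and let l = ord(γ). Then every nonzero vector in 𝔽_q² has orbit length l or p·l, and both lengths occur. -/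
open Matrix

/-- Powers of `!![2γ, -γ²; 1, 0]` are read off from its Jordan decomposition: `![γ, 1]` is an
eigenvector and `Q v - γ v` is `v 0 - γ * v 1` times it. -/
theorem smul_pow_mulVec_of_repeated_root {F : Type*} [CommRing F] (γ : F) (v : Fin 2 → F) (n : ℕ) :
    γ • ((!![2 * γ, -γ ^ 2; 1, 0] : Matrix (Fin 2) (Fin 2) F) ^ n *ᵥ v) =
      γ ^ n • (γ • v + (n * (v 0 - γ * v 1)) • ![γ, 1]) := by
  induction n with
  | zero => simp
  | succ n ih =>
    rw [pow_succ', ← mulVec_mulVec, ← mulVec_smul, ih]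
    ext i
    fin_cases i <;> simp [mulVec, dotProduct, Fin.sum_univ_two, vecHead, vecTail] <;> ring

theorem pow_mulVec_eq_self_iff_of_repeated_root {F : Type*} [Field F] {γ : F} (hγ : γ ≠ 0)
    {v : Fin 2 → F} (hv : v ≠ 0) (n : ℕ) :
    (!![2 * γ, -γ ^ 2; 1, 0] : Matrix (Fin 2) (Fin 2) F) ^ n *ᵥ v = v ↔
      γ ^ n = 1 ∧ (n : F) * (v 0 - γ * v 1) = 0 := by
  rw [← (smul_right_injective (Fin 2 → F) hγ).eq_iff]
  rw [smul_pow_mulVec_of_repeated_root]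
  constructor
  · intro h
    have h0 := congrFun h 0
    have h1 := congrFun h 1
    simp only [Pi.smul_apply, Pi.add_apply, smul_eq_mul, cons_val_zero, cons_val_one] at h0 h1
    have hpow : γ ^ n = 1 := by
      by_contra hne
      have hne' : γ ^ n - 1 ≠ 0 := sub_ne_zero.mpr hne
      have hd : v 0 - γ * v 1 = 0 := by
        have : (γ * (γ ^ n - 1)) * (v 0 - γ * v 1) = 0 := by linear_combination h0 - γ * h1
        exact (mul_eq_zero.mp this).resolve_left (mul_ne_zero hγ hne')
      rw [hd] at h0 h1
      apply hv
      ext i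
      fin_cases i
      · exact (mul_eq_zero.mp (by linear_combination h0 : (γ * (γ ^ n - 1)) * v 0 = 0)).resolve_left
          (mul_ne_zero hγ hne')
      · exact (mul_eq_zero.mp (by linear_combination h1 : (γ * (γ ^ n - 1)) * v 1 = 0)).resolve_left
          (mul_ne_zero hγ hne')
    refine ⟨hpow, ?_⟩
    rw [hpow] at h1
    linear_combination h1
  · rintro ⟨h1, h2⟩
    simp [h1, h2]

theorem coprime_orderOf_of_charP {F : Type*} [Field F] [Fintype F] (p : ℕ) [CharP F p] {γ : F}
    (hγ : γ ≠ 0) : p.Coprime (orderOf γ) := by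
  have hp : p.Prime := CharP.char_is_prime F p
  refine (Nat.Prime.coprime_iff_not_dvd hp).mpr fun hdvd => ?_
  have h1 : p ∣ Fintype.card F - 1 :=
    hdvd.trans (orderOf_dvd_of_pow_eq_one (FiniteField.pow_card_sub_one_eq_one γ hγ))
  have h2 : p ∣ Fintype.card F := (CharP.cast_eq_zero_iff F p _).mp (Nat.cast_card_eq_zero F)
  have h3 := Nat.dvd_sub h2 h1
  rw [Nat.sub_sub_self Fintype.card_pos] at h3
  exact hp.one_lt.ne' (Nat.dvd_one.mp h3)

theorem isLeast_pos_of_forall_iff_dvd {m : ℕ} (hm : 0 < m) {P : ℕ → Prop}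
    (h : ∀ n, P n ↔ m ∣ n) : IsLeast {n : ℕ | 0 < n ∧ P n} m :=
  ⟨⟨hm, (h m).mpr dvd_rfl⟩, fun n hn => Nat.le_of_dvd hn.1 ((h n).mp hn.2)⟩

/-- let `𝔽_q` have characteristic `p` and suppose the characteristic
polynomial of `Q = !![a, b; 1, 0]` has a repeated root `γ` (i.e. `a = 2γ`, `-b = γ²`),
with `l = ord(γ)`. Then every nonzero vector has orbit length `l` or `p·l`, and both
lengths occur. -/
theorem orbit_lengths_repeated_root {F : Type*} [Field F] [Fintype F]
    (p : ℕ) (hchar : CharP F p)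
    (a b : F) (hb : b ≠ 0)
    (Q : Matrix (Fin 2) (Fin 2) F) (hQ : Q = !![a, b; 1, 0])
    (γ : F) (ha : a = 2 * γ) (hbγ : -b = γ ^ 2)
    (l : ℕ) (hl : orderOf γ = l) :
    (∀ v : Fin 2 → F, v ≠ 0 →
      IsLeast {n : ℕ | 0 < n ∧ Q ^ n *ᵥ v = v} l ∨
      IsLeast {n : ℕ | 0 < n ∧ Q ^ n *ᵥ v = v} (p * l)) ∧
    (∃ v : Fin 2 → F, v ≠ 0 ∧ IsLeast {n : ℕ | 0 < n ∧ Q ^ n *ᵥ v = v} l) ∧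
    (∃ v : Fin 2 → F, v ≠ 0 ∧ IsLeast {n : ℕ | 0 < n ∧ Q ^ n *ᵥ v = v} (p * l)) := by
  have hγ : γ ≠ 0 := by
    rintro rfl
    exact hb (by simpa using hbγ)
  obtain rfl : b = -γ ^ 2 := by rw [← hbγ, neg_neg]
  subst hQ ha hl
  have hp : p.Prime := CharP.char_is_prime F p
  have hl : 0 < orderOf γ :=
    orderOf_pos_iff.mpr (isOfFinOrder_iff_pow_eq_one.mpr ⟨Fintype.card F - 1,
      Nat.sub_pos_of_lt Fintype.one_lt_card, FiniteField.pow_card_sub_one_eq_one γ hγ⟩)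
  have eigen (v : Fin 2 → F) (hv : v ≠ 0) (hd : v 0 - γ * v 1 = 0) :
      IsLeast {n : ℕ | 0 < n ∧ !![2 * γ, -γ ^ 2; 1, 0] ^ n *ᵥ v = v} (orderOf γ) :=
    isLeast_pos_of_forall_iff_dvd hl fun n => by
      rw [pow_mulVec_eq_self_iff_of_repeated_root hγ hv, hd, orderOf_dvd_iff_pow_eq_one]
      simp
  have generic (v : Fin 2 → F) (hv : v ≠ 0) (hd : v 0 - γ * v 1 ≠ 0) :
      IsLeast {n : ℕ | 0 < n ∧ !![2 * γ, -γ ^ 2; 1, 0] ^ n *ᵥ v = v} (p * orderOf γ) :=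
    isLeast_pos_of_forall_iff_dvd (Nat.mul_pos hp.pos hl) fun n => by
      rw [pow_mulVec_eq_self_iff_of_repeated_root hγ hv, mul_eq_zero, or_iff_left hd,
        CharP.cast_eq_zero_iff F p, ← orderOf_dvd_iff_pow_eq_one, and_comm]
      exact ⟨fun h => (coprime_orderOf_of_charP p hγ).mul_dvd_of_dvd_of_dvd h.1 h.2,
        fun h => ⟨dvd_of_mul_right_dvd h, dvd_of_mul_left_dvd h⟩⟩
  refine ⟨fun v hv => ?_, ⟨![γ, 1], ?_, eigen _ ?_ ?_⟩, ⟨![1, 0], ?_, generic _ ?_ ?_⟩⟩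
  · by_cases hd : v 0 - γ * v 1 = 0
    · exact .inl (eigen v hv hd)
    · exact .inr (generic v hv hd)
  all_goals simp
end

section
/- Let 𝔽_q have odd characteristic p, let b = 1, and suppose the characteristic polynomial p(x) = x² − a·x − 1 of Q has a repeated root γ in 𝔽_q. Then q ≡ 1 (mod 4), the order of γ in 𝔽_q^× is 4, and every nonzero vector in 𝔽_q² has orbit length 4 or 4p, with both lengths occurring. -/
open Matrix

section RepeatedRoot

variable {F : Type*} [Field F] {γ : F}

theorem pow_eq_smul_of_sq_eq_neg_one (hγ : γ ^ 2 = -1) (n : ℕ) :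
    (!![2 * γ, 1; 1, 0] : Matrix (Fin 2) (Fin 2) F) ^ n =
      γ ^ n • !![1 + (n : F), -(n * γ); -(n * γ), 1 - (n : F)] := by
  induction n with
  | zero => simp [one_fin_two]
  | succ k ih =>
    rw [pow_succ, ih]
    ext i j
    fin_cases i <;> fin_cases j <;> simp [pow_succ]
    · ring
    · linear_combination (γ ^ k * (k + 1)) * hγ
    · linear_combination (-γ ^ k * (k - 1)) * hγ
    · ring

theorem orderOf_eq_four_of_sq_eq_neg_one (h2 : (2 : F) ≠ 0) (hγ : γ ^ 2 = -1) :
    orderOf γ = 4 := by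
  refine orderOf_eq_prime_pow (p := 2) (n := 1) ?_ ?_
  · intro h
    rw [pow_one, hγ] at h
    exact h2 (by linear_combination -h)
  · norm_num
    linear_combination (γ ^ 2 - 1) * hγ

theorem pow_mulVec_eq_self_iff (hγ : γ ^ 2 = -1) (v : Fin 2 → F) (hv : v ≠ 0) (n : ℕ) :
    (!![2 * γ, 1; 1, 0] : Matrix (Fin 2) (Fin 2) F) ^ n *ᵥ v = v ↔
      γ ^ n = 1 ∧ (n : F) * (γ * v 0 + v 1) = 0 := by
  rw [pow_eq_smul_of_sq_eq_neg_one hγ, funext_iff, Fin.forall_fin_two]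
  simp only [Matrix.smul_apply, mulVec, dotProduct, Fin.sum_univ_two, of_apply,
    cons_val_zero, cons_val_one, smul_eq_mul, cons_val', cons_val_fin_one]
  constructor
  · rintro ⟨h0, h1⟩
    have hw : (γ ^ n - 1) * (γ * v 0 + v 1) = 0 := by
      linear_combination γ * h0 + h1 + γ ^ n * n * v 1 * hγ
    have hn : γ ^ n = 1 := by
      by_contra hne
      have hw0 := (mul_eq_zero.mp hw).resolve_left (sub_ne_zero.mpr hne)
      have hv0 : (γ ^ n - 1) * v 0 = 0 := by
        linear_combination h0 + γ ^ n * n * γ * hw0 - γ ^ n * n * v 0 * hγ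
      have hv0 := (mul_eq_zero.mp hv0).resolve_left (sub_ne_zero.mpr hne)
      have hv1 : v 1 = 0 := by linear_combination hw0 - γ * hv0
      exact hv (funext (Fin.forall_fin_two.mpr ⟨hv0, hv1⟩))
    refine ⟨hn, ?_⟩
    rw [hn] at h1
    linear_combination -h1
  · rintro ⟨hn, hw⟩
    rw [hn]
    exact ⟨by linear_combination -γ * hw + n * v 0 * hγ, by linear_combination -hw⟩

theorem isLeast_of_forall_iff_dvd {P : ℕ → Prop} {m : ℕ} (hm : 0 < m)
    (h : ∀ n, P n ↔ m ∣ n) : IsLeast {n : ℕ | 0 < n ∧ P n} m :=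
  ⟨⟨hm, (h m).mpr dvd_rfl⟩, fun n hn => Nat.le_of_dvd hn.1 ((h n).mp hn.2)⟩

theorem isLeast_four (h2 : (2 : F) ≠ 0) (hγ : γ ^ 2 = -1) (v : Fin 2 → F) (hv : v ≠ 0)
    (hw : γ * v 0 + v 1 = 0) :
    IsLeast {n : ℕ | 0 < n ∧ (!![2 * γ, 1; 1, 0] : Matrix (Fin 2) (Fin 2) F) ^ n *ᵥ v = v} 4 := by
  refine isLeast_of_forall_iff_dvd (by norm_num) fun n => ?_
  rw [pow_mulVec_eq_self_iff hγ v hv, ← orderOf_dvd_iff_pow_eq_one,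
    orderOf_eq_four_of_sq_eq_neg_one h2 hγ, hw]
  simp

theorem isLeast_four_mul_char (p : ℕ) [CharP F p] (hodd : Odd p) (h2 : (2 : F) ≠ 0)
    (hγ : γ ^ 2 = -1) (v : Fin 2 → F) (hv : v ≠ 0) (hw : γ * v 0 + v 1 ≠ 0) :
    IsLeast {n : ℕ | 0 < n ∧ (!![2 * γ, 1; 1, 0] : Matrix (Fin 2) (Fin 2) F) ^ n *ᵥ v = v}
      (4 * p) := by
  refine isLeast_of_forall_iff_dvd (Nat.mul_pos (by norm_num) hodd.pos) fun n => ?_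
  have hcop : Nat.Coprime 4 p := Nat.Coprime.pow_left 2 (Nat.coprime_two_left.mpr hodd)
  rw [pow_mulVec_eq_self_iff hγ v hv, ← orderOf_dvd_iff_pow_eq_one,
    orderOf_eq_four_of_sq_eq_neg_one h2 hγ, mul_eq_zero, or_iff_left hw,
    CharP.cast_eq_zero_iff F p]
  exact ⟨fun h => hcop.mul_dvd_of_dvd_of_dvd h.1 h.2,
    fun h => ⟨dvd_of_mul_right_dvd h, dvd_of_mul_left_dvd h⟩⟩

end RepeatedRoot

/-- let `𝔽_q` have odd characteristic `p`, let `b = 1`, and suppose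
`x² - a·x - 1` has a repeated root `γ` (i.e. `a = 2γ` and `γ² = -1`). Then
`q ≡ 1 (mod 4)`, `ord(γ) = 4`, and every nonzero vector has orbit length `4` or `4p`,
with both lengths occurring. -/
theorem repeated_root_b_eq_one {F : Type*} [Field F] [Fintype F]
    (p : ℕ) (hchar : CharP F p) (hodd : Odd p)
    (a : F)
    (Q : Matrix (Fin 2) (Fin 2) F) (hQ : Q = !![a, 1; 1, 0])
    (γ : F) (ha : a = 2 * γ) (hγ : γ ^ 2 = -1) :
    Fintype.card F % 4 = 1 ∧ orderOf γ = 4 ∧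
    (∀ v : Fin 2 → F, v ≠ 0 →
      IsLeast {n : ℕ | 0 < n ∧ Q ^ n *ᵥ v = v} 4 ∨
      IsLeast {n : ℕ | 0 < n ∧ Q ^ n *ᵥ v = v} (4 * p)) ∧
    (∃ v : Fin 2 → F, v ≠ 0 ∧ IsLeast {n : ℕ | 0 < n ∧ Q ^ n *ᵥ v = v} 4) ∧
    (∃ v : Fin 2 → F, v ≠ 0 ∧ IsLeast {n : ℕ | 0 < n ∧ Q ^ n *ᵥ v = v} (4 * p)) := by
  subst hQ ha
  have h2 : (2 : F) ≠ 0 := by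
    intro h
    have hdvd : p ∣ 2 := (CharP.cast_eq_zero_iff F p 2).mp (by exact_mod_cast h)
    have hp1 : p ≠ 1 := CharP.char_ne_one F p
    have hp : p ≤ 2 := Nat.le_of_dvd (by norm_num) hdvd
    obtain ⟨k, hk⟩ := hodd
    omega
  have hord := orderOf_eq_four_of_sq_eq_neg_one h2 hγ
  have hγ0 : γ ≠ 0 := by
    rintro rfl
    simp at hγ
  refine ⟨?_, hord, fun v hv => ?_, ⟨![1, -γ], ?_, ?_⟩, ⟨![0, 1], ?_, ?_⟩⟩
  · have hdvd := orderOf_dvd_of_pow_eq_one (FiniteField.pow_card_sub_one_eq_one γ hγ0)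
    have hcard := Fintype.card_pos (α := F)
    rw [hord] at hdvd
    omega
  · by_cases hw : γ * v 0 + v 1 = 0
    · exact Or.inl (isLeast_four h2 hγ v hv hw)
    · exact Or.inr (isLeast_four_mul_char p hodd h2 hγ v hv hw)
  · exact fun h => one_ne_zero (congrFun h 0)
  · exact isLeast_four h2 hγ ![1, -γ] (fun h => one_ne_zero (congrFun h 0)) (by simp)
  · exact fun h => one_ne_zero (congrFun h 1)
  · exact isLeast_four_mul_char p hodd h2 hγ ![0, 1] (fun h => one_ne_zero (congrFun h 1)) (by simp)
end

section
/- Let q ≡ 3 (mod 4), write q = 2s + 1 with s odd, and let γ₁, γ₂ ∈ 𝔽_q be distinct roots of the characteristic polynomial p(x) = x² − a·x − 1 of Q (so γ₁ + γ₂ = a and γ₁·γ₂ = −1). If ord(γ₁) = s, then γ₂ is a generator of the multiplicative group 𝔽_q^×, i.e., ord(γ₂) = q − 1. -/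
/-- let `q ≡ 3 (mod 4)` with `q = 2s + 1`, `s` odd, and let `γ₁ ≠ γ₂`
be the roots of `x² - a·x - 1` over `𝔽_q` (so `γ₁ + γ₂ = a`, `γ₁·γ₂ = -1`).
If `ord(γ₁) = s`, then `γ₂` generates `𝔽_q^×`, i.e. `ord(γ₂) = q - 1`. -/
theorem conjugate_root_is_LPR {F : Type*} [Field F] [Fintype F]
    (a : F) (s : ℕ) (hs : Odd s)
    (hq : Fintype.card F = 2 * s + 1) (hq3 : Fintype.card F % 4 = 3)
    (γ₁ γ₂ : F) (hne : γ₁ ≠ γ₂) (hsum : γ₁ + γ₂ = a) (hprod : γ₁ * γ₂ = -1)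
    (h1 : orderOf γ₁ = s) :
    orderOf γ₂ = Fintype.card F - 1 := by
  have hchar : ringChar F ≠ 2 := fun h => by
    have := FiniteField.even_card_iff_char_two.mp h
    omega
  have hγ₁ : γ₁ ≠ 0 := by
    rintro rfl
    simp at hprod
  have hinv : orderOf γ₁⁻¹ = s := by
    rw [← h1, ← Units.val_mk0 hγ₁, ← Units.val_inv_eq_inv_val, orderOf_units, orderOf_units,
      orderOf_inv]
  have hγ₂ : γ₂ = -1 * γ₁⁻¹ := by
    rw [← hprod]
    field_simp
  have hneg : orderOf (-1 : F) = 2 := by rw [orderOf_neg_one, if_neg hchar]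
  rw [hγ₂, (Commute.all _ _).orderOf_mul_eq_mul_orderOf_of_coprime, hneg, hinv, hq,
    Nat.add_sub_cancel]
  rw [hneg, hinv]
  exact hs.coprime_two_left
end

section
/- Suppose the characteristic polynomial p(x) = x² − a·x − b of Q is irreducible over 𝔽_q. Then all nonzero vectors of 𝔽_q² have the same orbit length; that is, for any nonzero v, w ∈ 𝔽_q², the least positive integer l with Q^l v = v equals the least positive integer l with Q^l w = w. -/
open Matrix Polynomial

/-- If an irreducible polynomial annihilates a square matrix `M`, then a polynomial in `M` that
kills a nonzero vector is zero. -/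
theorem Matrix.aeval_eq_zero_of_irreducible_of_mulVec_eq_zero {F n : Type*} [Field F] [Fintype n]
    [DecidableEq n] {M : Matrix n n F} {p r : F[X]} (hp : Irreducible p) (hM : aeval M p = 0)
    {v : n → F} (hv : v ≠ 0) (hr : aeval M r *ᵥ v = 0) : aeval M r = 0 := by
  have hdvd : p ∣ r := by
    by_contra hndvd
    obtain ⟨s, t, hst⟩ := hp.coprime_iff_not_dvd.mpr hndvd
    refine hv ?_
    calc v = aeval M (s * p + t * r) *ᵥ v := by rw [hst, map_one, one_mulVec]
      _ = 0 := by
        rw [map_add, map_mul, map_mul, hM, mul_zero, zero_add, ← mulVec_mulVec, hr, mulVec_zero]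
  obtain ⟨s, rfl⟩ := hdvd
  rw [map_mul, hM, zero_mul]

/-- If an irreducible polynomial annihilates a square matrix `M`, then a power of `M` fixes a given
nonzero vector if and only if it is the identity. -/
theorem Matrix.pow_mulVec_eq_self_iff_of_irreducible {F n : Type*} [Field F] [Fintype n]
    [DecidableEq n] {M : Matrix n n F} {p : F[X]} (hp : Irreducible p) (hM : aeval M p = 0)
    {v : n → F} (hv : v ≠ 0) (k : ℕ) : M ^ k *ᵥ v = v ↔ M ^ k = 1 := by
  refine ⟨fun h => ?_, fun h => by rw [h, one_mulVec]⟩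
  have hk : aeval M (X ^ k - 1 : F[X]) = M ^ k - 1 := by simp
  rw [← sub_eq_zero, ← hk]
  refine aeval_eq_zero_of_irreducible_of_mulVec_eq_zero hp hM hv ?_
  rw [hk, sub_mulVec, one_mulVec, h, sub_self]

/-- if the characteristic polynomial `x² - a·x - b` of
`Q = !![a, b; 1, 0]` is irreducible over `𝔽_q`, then all nonzero vectors have the
same orbit length: for nonzero `v, w`, the least positive `l` with `Q^l v = v`
equals the least positive `l` with `Q^l w = w`. -/
theorem orbit_lengths_irreducible {F : Type*} [Field F] [Fintype F]
    (a b : F) (hb : b ≠ 0)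
    (Q : Matrix (Fin 2) (Fin 2) F) (hQ : Q = !![a, b; 1, 0])
    (hirr : Irreducible (X ^ 2 - C a * X - C b : F[X]))
    (v w : Fin 2 → F) (hv : v ≠ 0) (hw : w ≠ 0) :
    sInf {n : ℕ | 0 < n ∧ Q ^ n *ᵥ v = v} = sInf {n : ℕ | 0 < n ∧ Q ^ n *ᵥ w = w} := by
  have hM : aeval Q (X ^ 2 - C a * X - C b : F[X]) = 0 := by
    subst hQ
    ext i j
    fin_cases i <;> fin_cases j <;>
      simp [pow_two, Matrix.mul_apply, Fin.sum_univ_two, algebraMap_eq_diagonal]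
  simp only [pow_mulVec_eq_self_iff_of_irreducible hirr hM hv,
    pow_mulVec_eq_self_iff_of_irreducible hirr hM hw]
end

section
/- Suppose the characteristic polynomial p(x) = x² − a·x − b of Q is irreducible over 𝔽_q. Then the orbit length of every nonzero vector in 𝔽_q² divides 2(q+1)·ord(b²); in particular, every nontrivial orbit length is at most 2(q+1)·ord(b²). -/
open Matrix Polynomial

/-- An irreducible quadratic `X² - aX - b` over a finite field with `q` elements divides
`X ^ (q + 1) + b`: its roots `α` and `α ^ q` have product `-b`. -/
theorem Irreducible.quadratic_dvd_X_pow_card_succ_add_C {F : Type*} [Field F] [Fintype F]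
    {a b : F} (hirr : Irreducible (X ^ 2 - C a * X - C b : F[X])) :
    (X ^ 2 - C a * X - C b : F[X]) ∣ X ^ (Fintype.card F + 1) + C b := by
  set q := Fintype.card F
  set p : F[X] := X ^ 2 - C a * X - C b with hp
  have hdeg : p.natDegree = 2 := by rw [hp]; compute_degree!
  have hexp : p ∣ (X ^ q) ^ 2 - C a * X ^ q - C b := by
    have h := FiniteField.expand_card p
    rw [hp] at h
    simp only [map_sub, map_mul, map_pow, expand_X, expand_C] at h
    rw [h]
    exact dvd_pow_self _ Fintype.card_ne_zero
  have hmul : p ∣ (X ^ q - X) * (X ^ q + X - C a) := by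
    convert dvd_sub hexp (dvd_refl p) using 1
    rw [hp]; ring
  rcases hirr.prime.dvd_or_dvd hmul with h | h
  · have hne : (X ^ q - X : F[X]) ≠ 0 :=
      FiniteField.X_pow_card_sub_X_ne_zero F Fintype.one_lt_card
    have hsplits : (X ^ q - X : F[X]).Splits := by
      rw [splits_iff_card_roots, FiniteField.roots_X_pow_card_sub_X,
        FiniteField.X_pow_card_sub_X_natDegree_eq F Fintype.one_lt_card]
      rfl
    have := (hsplits.of_dvd hne h).natDegree_eq_one_of_irreducible hirr
    omega
  · convert dvd_sub (h.mul_left X) (dvd_refl p) using 1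
    rw [hp]; ring

theorem Matrix.aeval_companion_quadratic {R : Type*} [CommRing R] (a b : R) :
    aeval !![a, b; 1, 0] (X ^ 2 - C a * X - C b : R[X]) = 0 := by
  ext i j
  fin_cases i <;> fin_cases j <;>
    simp [pow_two, Matrix.algebraMap_matrix_apply, Matrix.mul_apply]

theorem Matrix.isLeast_pow_mulVec_eq_dvd {n R : Type*} [Fintype n] [DecidableEq n] [Semiring R]
    {A : Matrix n n R} {v : n → R} {l m : ℕ}
    (hl : IsLeast {k : ℕ | 0 < k ∧ A ^ k *ᵥ v = v} l) (hm : A ^ m *ᵥ v = v) : l ∣ m := by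
  have hiter (k : ℕ) : (A *ᵥ ·)^[k] v = A ^ k *ᵥ v := by
    induction k with
    | zero => simp
    | succ k ih => rw [Function.iterate_succ_apply', ih, mulVec_mulVec, pow_succ']
  have hper (k : ℕ) : Function.IsPeriodicPt (A *ᵥ ·) k v ↔ A ^ k *ᵥ v = v := by
    rw [Function.IsPeriodicPt, Function.IsFixedPt, hiter]
  have hl' : l = Function.minimalPeriod (A *ᵥ ·) v :=
    le_antisymm
      (hl.2 ⟨((hper l).2 hl.1.2).minimalPeriod_pos hl.1.1,
        (hper _).1 (Function.isPeriodicPt_minimalPeriod _ _)⟩)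
      (((hper l).2 hl.1.2).minimalPeriod_le hl.1.1)
  rw [hl']
  exact ((hper m).2 hm).minimalPeriod_dvd

/-- if the characteristic polynomial `x² - a·x - b` of
`Q = !![a, b; 1, 0]` is irreducible over `𝔽_q`, then the orbit length of every
nonzero vector divides `2(q+1)·ord(b²)`; in particular it is at most
`2(q+1)·ord(b²)`. -/
theorem orbit_length_bound_irreducible {F : Type*} [Field F] [Fintype F]
    (a b : F) (hb : b ≠ 0)
    (Q : Matrix (Fin 2) (Fin 2) F) (hQ : Q = !![a, b; 1, 0])
    (hirr : Irreducible (X ^ 2 - C a * X - C b : F[X]))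
    (v : Fin 2 → F) (hv : v ≠ 0) (l : ℕ)
    (hl : IsLeast {n : ℕ | 0 < n ∧ Q ^ n *ᵥ v = v} l) :
    l ∣ 2 * (Fintype.card F + 1) * orderOf (b ^ 2) ∧
      l ≤ 2 * (Fintype.card F + 1) * orderOf (b ^ 2) := by
  have hpow : Q ^ (Fintype.card F + 1) = algebraMap F _ (-b) := by
    obtain ⟨r, hr⟩ := hirr.quadratic_dvd_X_pow_card_succ_add_C
    have h := congrArg (aeval Q) hr
    rw [map_mul, hQ, aeval_companion_quadratic, zero_mul, ← hQ] at h
    simp only [map_add, map_pow, aeval_X, aeval_C] at h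
    rw [map_neg]
    exact eq_neg_of_add_eq_zero_left h
  have hone : Q ^ (2 * (Fintype.card F + 1) * orderOf (b ^ 2)) = 1 := by
    rw [mul_comm 2, pow_mul, pow_mul, hpow, ← map_pow, ← map_pow, neg_sq, pow_orderOf_eq_one,
      map_one]
  have hdvd : l ∣ 2 * (Fintype.card F + 1) * orderOf (b ^ 2) :=
    isLeast_pow_mulVec_eq_dvd hl (by rw [hone, one_mulVec])
  have hord : 0 < orderOf (b ^ 2) :=
    orderOf_pos_iff.2 (isOfFinOrder_iff_pow_eq_one.2
      ⟨Fintype.card F - 1, Nat.sub_pos_of_lt Fintype.one_lt_card,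
        FiniteField.pow_card_sub_one_eq_one _ (pow_ne_zero 2 hb)⟩)
  exact ⟨hdvd, Nat.le_of_dvd (by positivity) hdvd⟩
end
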